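/- For the decentralized online learning algorithm in the reproducing kernel Hilbert space H_K, suppose 𝒢 is connected and Assumptions A3, A4, A5 and Conditions C1, C2, C3 hold. If there exist positive self-adjoint operators N₁, …, N_N ∈ L(H_K) with ∑_{i=1}^N Nᵢ strictly positive, an integer h > 0, a constant μ₀ > 0, and a nonnegative real sequence τ(k) with ∑_k τ(k) < ∞, such that max_{j∈V} ‖N_j − ∑_{i=kh}^{(k+1)h−1} E[K_{x_j(i)} ⊗ K_{x_j(i)} | 𝓕(kh−1)]‖²_{L(H_K)} ≤ μ₀ τ(k) a.s. for every k, then the algorithm is both mean square consistent and almost surely strongly consistent; moreover it is pointwisely almost surely strongly consistent: for every x ∈ 𝒳 and i ∈ V, lim_{k→∞} f_i(k)(x) = f₀(x) almost surely. -/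

import Mathlib

open MeasureTheory ProbabilityTheory Filter ENNReal RealInnerProductSpace

noncomputable section

/-- The rank-one operator `φ ⊗ ψ ∈ L(H)`, `(φ ⊗ ψ) f = ⟪f, ψ⟫ φ`. -/
def rankOne {H : Type*} [NormedAddCommGroup H] [InnerProductSpace ℝ H] (φ ψ : H) : H →L[ℝ] H :=
  (innerSL ℝ ψ).smulRight φ

/-- The σ-algebra `𝓕(k−1)` generated by the random variables `f(x_i(s)) = ⟪f, K_{x_i(s)}⟫`
(`f ∈ H_K`, `i ∈ V`) and `v_i(s)` (`i ∈ V`) for `0 ≤ s ≤ k−1` (so `rkhsFilt Kx xi v 0` is the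
trivial σ-algebra `𝓕(−1)`). -/
def rkhsFilt {Ω S HK : Type*} [MeasurableSpace Ω]
    [NormedAddCommGroup HK] [InnerProductSpace ℝ HK]
    {N : ℕ} (Kx : S → HK) (xi : Fin N → ℕ → Ω → S) (v : Fin N → ℕ → Ω → ℝ) (k : ℕ) :
    MeasurableSpace Ω :=
  ⨆ s ∈ Finset.range k, ⨆ i : Fin N,
    ((⨆ g : HK, MeasurableSpace.comap (fun ω => ⟪g, Kx (xi i s ω)⟫) (borel ℝ)) ⊔
      MeasurableSpace.comap (fun ω => v i s ω) (borel ℝ))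

section PositiveOperators

variable {E : Type*} [NormedAddCommGroup E] [InnerProductSpace ℝ E]

lemma ContinuousLinearMap.IsPositive.norm_apply_sq_le {T : E →L[ℝ] E} (hT : T.IsPositive)
    {M : ℝ} (hM : ‖T‖ ≤ M) (x : E) : ‖T x‖ ^ 2 ≤ M * ⟪T x, x⟫ := by
  rcases (norm_nonneg T).eq_or_lt with h0 | h0
  · have : T = 0 := norm_eq_zero.1 h0.symm
    simp [this]
  have hMpos : 0 < M := h0.trans_le hM
  have hpos : 0 ≤ ⟪T (x - M⁻¹ • T x), x - M⁻¹ • T x⟫ := hT.inner_nonneg_left _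
  have hsym : ⟪T (T x), x⟫ = ‖T x‖ ^ 2 := by
    rw [← real_inner_self_eq_norm_sq]
    exact hT.isSymmetric (T x) x
  have hTT : ⟪T (T x), T x⟫ ≤ M * ‖T x‖ ^ 2 := by
    calc ⟪T (T x), T x⟫ ≤ ‖T (T x)‖ * ‖T x‖ := real_inner_le_norm _ _
      _ ≤ (M * ‖T x‖) * ‖T x‖ := by gcongr; exact T.le_of_opNorm_le hM _
      _ = M * ‖T x‖ ^ 2 := by ring
  simp only [map_sub, map_smul, inner_sub_left, inner_sub_right, real_inner_smul_left,
    real_inner_smul_right, hsym, real_inner_self_eq_norm_sq] at hpos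
  have h1 : M⁻¹ * (M⁻¹ * ⟪T (T x), T x⟫) ≤ M⁻¹ * ‖T x‖ ^ 2 := by
    have : M⁻¹ * ⟪T (T x), T x⟫ ≤ ‖T x‖ ^ 2 := by
      rw [inv_mul_le_iff₀ hMpos]; exact hTT
    gcongr
  have h2 : M⁻¹ * ‖T x‖ ^ 2 ≤ ⟪T x, x⟫ := by linarith
  rwa [inv_mul_le_iff₀ hMpos] at h2

lemma ContinuousLinearMap.IsPositive.norm_sub_apply_sq_le {T : E →L[ℝ] E} (hT : T.IsPositive)
    (h1 : ‖T‖ ≤ 1) (x : E) : ‖x - T x‖ ^ 2 ≤ ‖x‖ ^ 2 - ⟪T x, x⟫ := by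
  have := hT.norm_apply_sq_le h1 x
  rw [norm_sub_sq_real, real_inner_comm]
  linarith

lemma ContinuousLinearMap.IsPositive.norm_sub_apply_le {T : E →L[ℝ] E} (hT : T.IsPositive)
    (h1 : ‖T‖ ≤ 1) (x : E) : ‖x - T x‖ ≤ ‖x‖ := by
  have h2 := hT.norm_sub_apply_sq_le h1 x
  have h3 := hT.inner_nonneg_left x
  exact le_of_sq_le_sq (by linarith) (norm_nonneg _)

/-- The product `(1 - D (k - 1)) ⋯ (1 - D 0)`. -/
def propagator (D : ℕ → E →L[ℝ] E) : ℕ → E →L[ℝ] E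
  | 0 => 1
  | k + 1 => (1 - D k) ∘L propagator D k

@[simp] lemma propagator_zero (D : ℕ → E →L[ℝ] E) (x : E) : propagator D 0 x = x := rfl

lemma propagator_succ (D : ℕ → E →L[ℝ] E) (k : ℕ) (x : E) :
    propagator D (k + 1) x = propagator D k x - D k (propagator D k x) := rfl

lemma propagator_add (D : ℕ → E →L[ℝ] E) (n k : ℕ) (x : E) :
    propagator D (n + k) x = propagator (fun l => D (n + l)) k (propagator D n x) := by
  induction k with
  | zero => rfl
  | succ k ih => rw [← add_assoc, propagator_succ, propagator_succ, ih]

lemma norm_propagator_apply_le {D : ℕ → E →L[ℝ] E} (hD : ∀ l, (D l).IsPositive)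
    (h1 : ∀ l, ‖D l‖ ≤ 1) (k : ℕ) (x : E) : ‖propagator D k x‖ ≤ ‖x‖ := by
  induction k with
  | zero => simp
  | succ k ih => exact ((hD k).norm_sub_apply_le (h1 k) _).trans ih

lemma norm_propagator_sub_le {D : ℕ → E →L[ℝ] E} (hD : ∀ l, (D l).IsPositive)
    {d : ℕ → ℝ} (hd : ∀ l, ‖D l‖ ≤ d l) (hd1 : ∀ l, d l ≤ 1) (k : ℕ) (x : E) :
    ‖propagator D k x - x‖ ≤ (∑ l ∈ Finset.range k, d l) * ‖x‖ := by
  induction k with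
  | zero => simp
  | succ k ih =>
    rw [propagator_succ, Finset.sum_range_succ, add_mul, sub_right_comm]
    refine (norm_sub_le _ _).trans (add_le_add ih ?_)
    refine ((D k).le_of_opNorm_le (hd k) _).trans ?_
    gcongr
    · exact (norm_nonneg _).trans (hd k)
    · exact norm_propagator_apply_le hD (fun l => (hd l).trans (hd1 l)) k x

lemma norm_propagator_sub_first_order_le {D : ℕ → E →L[ℝ] E} (hD : ∀ l, (D l).IsPositive)
    {d : ℕ → ℝ} (hd : ∀ l, ‖D l‖ ≤ d l) (hd1 : ∀ l, d l ≤ 1) (k : ℕ) (x : E) :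
    ‖propagator D k x - (x - ∑ l ∈ Finset.range k, D l x)‖
      ≤ (∑ l ∈ Finset.range k, d l) ^ 2 * ‖x‖ := by
  induction k with
  | zero => simp
  | succ k ih =>
    have hdk : 0 ≤ d k := (norm_nonneg _).trans (hd k)
    have hs : 0 ≤ ∑ l ∈ Finset.range k, d l :=
      Finset.sum_nonneg fun l _ => (norm_nonneg _).trans (hd l)
    have key : propagator D (k + 1) x - (x - ∑ l ∈ Finset.range (k + 1), D l x)
        = (propagator D k x - (x - ∑ l ∈ Finset.range k, D l x))
          - D k (propagator D k x - x) := by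
      rw [propagator_succ, Finset.sum_range_succ, map_sub]
      abel
    have h2 : ‖D k (propagator D k x - x)‖ ≤ d k * ((∑ l ∈ Finset.range k, d l) * ‖x‖) :=
      ((D k).le_of_opNorm_le (hd k) _).trans
        (mul_le_mul_of_nonneg_left (norm_propagator_sub_le hD hd hd1 k x) hdk)
    rw [key, Finset.sum_range_succ]
    refine (norm_sub_le _ _).trans ((add_le_add ih h2).trans ?_)
    nlinarith [norm_nonneg x, mul_nonneg hs hdk, mul_nonneg (mul_nonneg hs hdk) (norm_nonneg x),
      mul_nonneg (sq_nonneg (d k)) (norm_nonneg x)]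

/-- Over a block with almost constant gains, the products of `1 - (a T + b L)` are
approximated to first order by freezing the gains. -/
lemma norm_propagator_sub_frozen_le {T : ℕ → E →L[ℝ] E} {L : E →L[ℝ] E}
    (hT : ∀ l, (T l).IsPositive) (hL : L.IsPositive) {κ lam : ℝ} (hTκ : ∀ l, ‖T l‖ ≤ κ)
    (hLlam : ‖L‖ ≤ lam) {a b : ℕ → ℝ} (ha : ∀ l, 0 ≤ a l) (hb : ∀ l, 0 ≤ b l)
    (hd1 : ∀ l, a l * κ + b l * lam ≤ 1) {h : ℕ} {α ρ : ℝ}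
    (haρ : ∀ l < h, |a l - α| ≤ ρ) (hbρ : ∀ l < h, |b l - α| ≤ ρ) (x : E) :
    ‖propagator (fun l => a l • T l + b l • L) h x
        - (x - α • ((∑ l ∈ Finset.range h, T l + (h : ℝ) • L) x))‖
      ≤ ((∑ l ∈ Finset.range h, (a l * κ + b l * lam)) ^ 2 + h * (ρ * (κ + lam))) * ‖x‖ := by
  have hD : ∀ l, (a l • T l + b l • L).IsPositive := fun l =>
    ((hT l).smul_of_nonneg (ha l)).add (hL.smul_of_nonneg (hb l))
  have hd : ∀ l, ‖a l • T l + b l • L‖ ≤ a l * κ + b l * lam := fun l => by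
    refine (norm_add_le _ _).trans ?_
    rw [norm_smul, norm_smul, Real.norm_of_nonneg (ha l), Real.norm_of_nonneg (hb l)]
    gcongr
    · exact ha l
    · exact hTκ l
    · exact hb l
  have h1 := norm_propagator_sub_first_order_le hD hd hd1 h x
  have h2 : ‖∑ l ∈ Finset.range h, (a l • T l + b l • L) x
      - α • ((∑ l ∈ Finset.range h, T l + (h : ℝ) • L) x)‖ ≤ h * (ρ * (κ + lam)) * ‖x‖ := by
    have e1 : α • ((∑ l ∈ Finset.range h, T l + (h : ℝ) • L) x)
        = ∑ l ∈ Finset.range h, α • (T l x + L x) := by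
      simp only [add_apply, sum_apply,
        smul_apply, ← Finset.smul_sum, Finset.sum_add_distrib,
        Finset.sum_const, Finset.card_range, Nat.cast_smul_eq_nsmul]
    rw [e1, ← Finset.sum_sub_distrib]
    refine (norm_sum_le_of_le (f := fun l => (a l • T l + b l • L) x - α • (T l x + L x))
      (n := fun _ => ρ * (κ + lam) * ‖x‖) _ fun l hl => ?_).trans (by simp [mul_assoc])
    have e2 : (a l • T l + b l • L) x - α • (T l x + L x)
        = (a l - α) • T l x + (b l - α) • L x := by
      simp only [add_apply, smul_apply]
      module
    rw [e2]
    have hl' := Finset.mem_range.1 hl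
    refine (norm_add_le _ _).trans ?_
    rw [norm_smul, norm_smul, Real.norm_eq_abs, Real.norm_eq_abs]
    have hρ : 0 ≤ ρ := (abs_nonneg _).trans (haρ l hl')
    calc _ ≤ ρ * (κ * ‖x‖) + ρ * (lam * ‖x‖) := by
          gcongr
          · exact haρ l hl'
          · exact (T l).le_of_opNorm_le (hTκ l) x
          · exact hbρ l hl'
          · exact L.le_of_opNorm_le hLlam x
      _ = _ := by ring
  have key : propagator (fun l => a l • T l + b l • L) h x
        - (x - α • ((∑ l ∈ Finset.range h, T l + (h : ℝ) • L) x))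
      = (propagator (fun l => a l • T l + b l • L) h x
          - (x - ∑ l ∈ Finset.range h, (a l • T l + b l • L) x))
        - (∑ l ∈ Finset.range h, (a l • T l + b l • L) x
          - α • ((∑ l ∈ Finset.range h, T l + (h : ℝ) • L) x)) := by abel
  rw [key, add_mul]
  exact (norm_sub_le _ _).trans (add_le_add h1 h2)

/-- If `Q` is strictly positive and `∑ α = ∞`, the products of `1 - α Q` tend to zero strongly. -/
lemma tendsto_propagator_smul_zero [CompleteSpace E] {Q : E →L[ℝ] E} (hQ : Q.IsPositive)
    (hQ0 : ∀ x, x ≠ 0 → 0 < ⟪Q x, x⟫) {α : ℕ → ℝ} (hα : ∀ k, 0 ≤ α k)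
    (hα1 : ∀ k, ‖α k • Q‖ ≤ 1) (hαs : ¬ Summable α) (x : E) :
    Tendsto (fun k => propagator (fun l => α l • Q) k x) atTop (nhds 0) := by
  have hpos : ∀ k, (α k • Q).IsPositive := fun k => hQ.smul_of_nonneg (hα k)
  have hcomm : ∀ k y, propagator (fun l => α l • Q) k (Q y)
      = Q (propagator (fun l => α l • Q) k y) := by
    intro k y
    induction k with
    | zero => rfl
    | succ k ih =>
      simp only [propagator_succ, ih, map_sub, smul_apply, map_smul]
  have hrange : ∀ y, Tendsto (fun k => propagator (fun l => α l • Q) k (Q y)) atTop (nhds 0) := by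
    intro y
    set z : ℕ → E := fun k => propagator (fun l => α l • Q) k (Q y) with hz
    have hanti : Antitone fun k => ‖z k‖ :=
      antitone_nat_of_succ_le fun k => (hpos k).norm_sub_apply_le (hα1 k) _
    obtain ⟨c, hc⟩ : ∃ c, Tendsto (fun k => ‖z k‖) atTop (nhds c) :=
      ⟨_, tendsto_atTop_ciInf hanti ⟨0, by rintro _ ⟨k, rfl⟩; positivity⟩⟩
    have hle : ∀ k, c ≤ ‖z k‖ := fun k => hanti.le_of_tendsto hc k
    have hc0 : 0 ≤ c := ge_of_tendsto' hc fun k => norm_nonneg _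
    rcases hc0.eq_or_lt with h0 | h0
    · rw [← h0] at hc
      exact tendsto_zero_iff_norm_tendsto_zero.2 hc
    refine absurd ?_ hαs
    set M := ‖Q‖ + 1
    have hM : 0 < M := by positivity
    have hsum : ∀ n, ∑ k ∈ Finset.range n, α k * (c ^ 2 / M) ≤ ‖y‖ ^ 2
        - ‖propagator (fun l => α l • Q) n y‖ ^ 2 := by
      intro n
      induction n with
      | zero => simp
      | succ n ih =>
        rw [Finset.sum_range_succ, propagator_succ]
        have h1 := (hpos n).norm_sub_apply_sq_le (hα1 n) (propagator (fun l => α l • Q) n y)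
        have h2 := hQ.norm_apply_sq_le (M := M) (by simp [M]) (propagator (fun l => α l • Q) n y)
        rw [← hcomm] at h2
        have h3 : c ^ 2 / M ≤ ⟪propagator (fun l => α l • Q) n (Q y),
            propagator (fun l => α l • Q) n y⟫ := by
          rw [div_le_iff₀ hM, mul_comm]
          exact (pow_le_pow_left₀ hc0 (hle n) 2).trans h2
        have h4 := mul_le_mul_of_nonneg_left h3 (hα n)
        simp only [smul_apply, real_inner_smul_left, ← hcomm] at h1 ⊢
        linarith
    have : Summable fun k => α k * (c ^ 2 / M) :=
      summable_of_sum_range_le (fun k => by have := hα k; positivity)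
        fun n => (hsum n).trans (sub_le_self _ (by positivity))
    exact (summable_mul_right_iff (by positivity)).1 this
  have hdense : Dense (Set.range Q) := by
    have hbot : Q.rangeᗮ = ⊥ := by
      rw [Submodule.eq_bot_iff]
      intro w hw
      by_contra hne
      have := hQ0 w hne
      rw [(Submodule.mem_orthogonal _ _).1 hw (Q w) ⟨w, rfl⟩] at this
      exact lt_irrefl _ this
    exact Submodule.dense_iff_topologicalClosure_eq_top.2
      (Submodule.topologicalClosure_eq_top_iff.2 hbot)
  rw [Metric.tendsto_atTop]
  intro ε hε
  obtain ⟨_, ⟨y, rfl⟩, hy⟩ := hdense.exists_dist_lt x (half_pos hε)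
  obtain ⟨n, hn⟩ := Metric.tendsto_atTop.1 (hrange y) (ε / 2) (half_pos hε)
  refine ⟨n, fun k hk => ?_⟩
  have h1 := hn k hk
  rw [dist_zero_right] at h1 ⊢
  have h2 := norm_propagator_apply_le hpos hα1 k (x - Q y)
  rw [map_sub, ← dist_eq_norm x] at h2
  have h3 := norm_le_norm_sub_add (propagator (fun l => α l • Q) k x)
    (propagator (fun l => α l • Q) k (Q y))
  linarith

end PositiveOperators

section SecondMoments

variable {Ω E : Type*} [NormedAddCommGroup E] [InnerProductSpace ℝ E] {m m0 : MeasurableSpace Ω}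
  {P : Measure Ω}

lemma MeasureTheory.StronglyMeasurable.opApply {D : Ω → E →L[ℝ] E} {x : Ω → E}
    (hD : StronglyMeasurable[m] D) (hx : StronglyMeasurable[m] x) :
    StronglyMeasurable[m] fun ω => D ω (x ω) :=
  isBoundedBilinearMap_apply.continuous.comp_stronglyMeasurable (hD.prodMk hx)

lemma MeasureTheory.MemLp.integrable_inner_of_two {p q : Ω → E} (hp : MemLp p 2 P)
    (hq : MemLp q 2 P) : Integrable (fun ω => ⟪p ω, q ω⟫) P := by
  refine ((hp.integrable_norm_pow two_ne_zero).add (hq.integrable_norm_pow two_ne_zero)).mono'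
    (hp.1.inner hq.1) (ae_of_all _ fun ω => ?_)
  have := abs_real_inner_le_norm (p ω) (q ω)
  rw [Real.norm_eq_abs]
  simp only [Pi.add_apply]
  nlinarith [sq_nonneg (‖p ω‖ - ‖q ω‖), sq_nonneg (‖p ω‖ + ‖q ω‖)]

/-- The random element `n` is orthogonal in mean to all square integrable `m`-measurable random
elements. -/
def MeanOrthogonal (m : MeasurableSpace Ω) {m0 : MeasurableSpace Ω} (P : Measure Ω)
    (n : Ω → E) : Prop :=
  ∀ p : Ω → E, StronglyMeasurable[m] p → MemLp p 2 P → ∫ ω, ⟪p ω, n ω⟫ ∂P = 0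

lemma MeanOrthogonal.setIntegral_eq_zero {n : Ω → E} (hn : MeanOrthogonal m P n) (hm : m ≤ m0)
    {p : Ω → E} (hp : StronglyMeasurable[m] p) (hp2 : MemLp p 2 P) {s : Set Ω}
    (hs : MeasurableSet[m] s) : ∫ ω in s, ⟪p ω, n ω⟫ ∂P = 0 := by
  rw [← integral_indicator (hm s hs), ← hn _ (hp.indicator hs) (hp2.indicator (hm s hs))]
  refine integral_congr_ae (ae_of_all _ fun ω => ?_)
  by_cases hω : ω ∈ s <;> simp [hω]

lemma MeasureTheory.StronglyMeasurable.subOpApply {D : Ω → E →L[ℝ] E} {x : Ω → E}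
    (hx : StronglyMeasurable[m] x) (hD : StronglyMeasurable[m] D) :
    StronglyMeasurable[m] fun ω => x ω - D ω (x ω) :=
  hx.sub (hD.opApply hx)

lemma MeasureTheory.MemLp.contraction {x : Ω → E} {D : Ω → E →L[ℝ] E} (hm : m ≤ m0)
    (hx : StronglyMeasurable[m] x) (hx2 : MemLp x 2 P) (hDm : StronglyMeasurable[m] D)
    (hD : ∀ ω, (D ω).IsPositive) (hD1 : ∀ ω, ‖D ω‖ ≤ 1) :
    MemLp (fun ω => x ω - D ω (x ω)) 2 P :=
  hx2.mono ((hx.subOpApply hDm).mono hm).aestronglyMeasurable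
    (ae_of_all _ fun ω => (hD ω).norm_sub_apply_le (hD1 ω) (x ω))

lemma integral_norm_sq_contraction_add_noise_le {x : Ω → E} {D : Ω → E →L[ℝ] E} {n : Ω → E}
    (hm : m ≤ m0)
    (hx : StronglyMeasurable[m] x) (hx2 : MemLp x 2 P) (hDm : StronglyMeasurable[m] D)
    (hD : ∀ ω, (D ω).IsPositive) (hD1 : ∀ ω, ‖D ω‖ ≤ 1)
    (hn2 : MemLp n 2 P) (hn : MeanOrthogonal m P n) (c : ℝ) :
    ∫ ω, ‖x ω - D ω (x ω) + c • n ω‖ ^ 2 ∂P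
      ≤ ∫ ω, ‖x ω‖ ^ 2 ∂P + c ^ 2 * ∫ ω, ‖n ω‖ ^ 2 ∂P := by
  have hp := hx2.contraction hm hx hDm hD hD1
  have e1 : ∀ ω, ‖x ω - D ω (x ω) + c • n ω‖ ^ 2
      = ‖x ω - D ω (x ω)‖ ^ 2 + 2 * c * ⟪x ω - D ω (x ω), n ω⟫ + c ^ 2 * ‖n ω‖ ^ 2 := by
    intro ω
    rw [norm_add_sq_real, real_inner_smul_right, norm_smul, mul_pow, Real.norm_eq_abs, sq_abs]
    ring
  have i1 := hp.integrable_norm_pow two_ne_zero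
  have i2 := (hp.integrable_inner_of_two hn2).const_mul (2 * c)
  have i3 := (hn2.integrable_norm_pow two_ne_zero).const_mul (c ^ 2)
  have i12 : Integrable (fun ω => ‖x ω - D ω (x ω)‖ ^ 2
      + 2 * c * ⟪x ω - D ω (x ω), n ω⟫) P := i1.add i2
  simp_rw [e1]
  rw [integral_add i12 i3, integral_add i1 i2, integral_const_mul, integral_const_mul,
    hn _ (hx.subOpApply hDm) hp, mul_zero, add_zero]
  gcongr ?_ + _
  refine integral_mono i1 (hx2.integrable_norm_pow two_ne_zero) fun ω => ?_
  have := (hD ω).norm_sub_apply_le (hD1 ω) (x ω)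
  dsimp only
  gcongr

lemma integral_norm_sq_add_le {F : Type*} [NormedAddCommGroup F] {x y : Ω → F}
    (hx : MemLp x 2 P) (hy : MemLp y 2 P) :
    ∫ ω, ‖x ω + y ω‖ ^ 2 ∂P ≤ 2 * ∫ ω, ‖x ω‖ ^ 2 ∂P + 2 * ∫ ω, ‖y ω‖ ^ 2 ∂P := by
  have i1 := (hx.integrable_norm_pow two_ne_zero).const_mul 2
  have i2 := (hy.integrable_norm_pow two_ne_zero).const_mul 2
  rw [← integral_const_mul, ← integral_const_mul, ← integral_add i1 i2]
  refine integral_mono ((hx.add hy).integrable_norm_pow two_ne_zero) (i1.add i2) fun ω => ?_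
  have := norm_add_le (x ω) (y ω)
  have h2 : ‖x ω + y ω‖ ^ 2 ≤ (‖x ω‖ + ‖y ω‖) ^ 2 := by gcongr
  dsimp only
  nlinarith [sq_nonneg (‖x ω‖ - ‖y ω‖)]

variable [IsProbabilityMeasure P]

/-- Products of positive contractions driven by a square integrable martingale difference noise:
the iterates converge almost surely to zero as soon as they do so in mean square. -/
lemma ae_tendsto_zero_of_contraction_add_noise {G : Filtration ℕ m0} {e n : ℕ → Ω → E}
    {D : ℕ → Ω → E →L[ℝ] E} {a : ℕ → ℝ} {c : ℝ}
    (he : ∀ k, StronglyMeasurable[G k] (e k)) (he2 : ∀ k, MemLp (e k) 2 P)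
    (hDm : ∀ k, StronglyMeasurable[G k] (D k))
    (hD : ∀ k ω, (D k ω).IsPositive) (hD1 : ∀ k ω, ‖D k ω‖ ≤ 1)
    (hnm : ∀ k, StronglyMeasurable[G (k + 1)] (n k)) (hn2 : ∀ k, MemLp (n k) 2 P)
    (hn : ∀ k, MeanOrthogonal (G k) P (n k)) (hnc : ∀ k, ∫ ω, ‖n k ω‖ ^ 2 ∂P ≤ c)
    (ha : Summable fun k => a k ^ 2)
    (hrec : ∀ k ω, e (k + 1) ω = e k ω - D k ω (e k ω) + a k • n k ω)
    (hlim : Tendsto (fun k => ∫ ω, ‖e k ω‖ ^ 2 ∂P) atTop (nhds 0)) :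
    ∀ᵐ ω ∂P, Tendsto (fun k => ‖e k ω‖) atTop (nhds 0) := by
  have hnint := fun k => (hn2 k).integrable_norm_pow two_ne_zero
  have heint := fun k => (he2 k).integrable_norm_pow two_ne_zero
  set S : ℕ → Ω → ℝ := fun k ω => ∑ j ∈ Finset.range k, a j ^ 2 * ‖n j ω‖ ^ 2 with hSdef
  have hSint : ∀ k, Integrable (S k) P := fun k =>
    integrable_finsetSum _ fun j _ => (hnint j).const_mul _
  have hSm : ∀ k, StronglyMeasurable[G k] (S k) := fun k =>
    Finset.stronglyMeasurable_fun_sum _ fun j hj =>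
      (((hnm j).mono (G.mono (Finset.mem_range.1 hj))).norm.pow 2).const_mul _
  have hS0 : ∀ k ω, 0 ≤ S k ω := fun k ω => Finset.sum_nonneg fun j _ => by positivity
  have hc : 0 ≤ c := (integral_nonneg fun ω => by positivity).trans (hnc 0)
  have hSI : ∀ k, ∫ ω, S k ω ∂P ≤ (∑' j, a j ^ 2) * c := by
    intro k
    simp only [hSdef]
    rw [integral_finsetSum _ fun j _ => (hnint j).const_mul _]
    simp_rw [integral_const_mul]
    calc _ ≤ ∑ j ∈ Finset.range k, a j ^ 2 * c := by
          gcongr with j; exact hnc j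
      _ = (∑ j ∈ Finset.range k, a j ^ 2) * c := by rw [Finset.sum_mul]
      _ ≤ _ := by
          gcongr
          exact ha.sum_le_tsum _ fun _ _ => sq_nonneg _
  obtain ⟨B, hB⟩ := hlim.bddAbove_range
  have hB' : ∀ k, ∫ ω, ‖e k ω‖ ^ 2 ∂P ≤ B := fun k => hB ⟨k, rfl⟩
  have hconvS : ∀ᵐ ω ∂P, ∃ l, Tendsto (fun k => S k ω) atTop (nhds l) := by
    have hsub : Submartingale S G P := by
      refine submartingale_of_setIntegral_le_succ hSm hSint fun k s _ => ?_
      refine setIntegral_mono (hSint k).integrableOn (hSint (k + 1)).integrableOn fun ω => ?_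
      simp only [hSdef, Finset.sum_range_succ]
      exact le_add_of_nonneg_right (by positivity)
    refine hsub.exists_ae_tendsto_of_bdd (R := ((∑' j, a j ^ 2) * c).toNNReal) fun k => ?_
    rw [eLpNorm_one_eq_lintegral_enorm, ← ofReal_integral_norm_eq_lintegral_enorm (hSint k)]
    refine ENNReal.ofReal_le_ofReal ?_
    simp_rw [Real.norm_of_nonneg (hS0 k _)]
    exact hSI k
  have hconvY : ∀ᵐ ω ∂P, ∃ l, Tendsto (fun k => S k ω - ‖e k ω‖ ^ 2) atTop (nhds l) := by
    have hint : ∀ k, Integrable (fun ω => S k ω - ‖e k ω‖ ^ 2) P :=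
      fun k => (hSint k).sub (heint k)
    have hsub : Submartingale (fun k ω => S k ω - ‖e k ω‖ ^ 2) G P := by
      refine submartingale_of_setIntegral_le_succ (fun k => (hSm k).sub ((he k).norm.pow 2)) hint
        fun k s hs => ?_
      have hp := (he2 k).contraction (G.le k) (he k) (hDm k) (hD k) (hD1 k)
      have hI := (hp.integrable_inner_of_two (hn2 k)).const_mul (2 * a k)
      have hz : ∫ ω in s, 2 * a k * ⟪e k ω - D k ω (e k ω), n k ω⟫ ∂P = 0 := by
        rw [integral_const_mul, (hn k).setIntegral_eq_zero (G.le k)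
          ((he k).subOpApply (hDm k)) hp hs, mul_zero]
      calc ∫ ω in s, (S k ω - ‖e k ω‖ ^ 2) ∂P
          = ∫ ω in s, ((S k ω - ‖e k ω‖ ^ 2)
              - 2 * a k * ⟪e k ω - D k ω (e k ω), n k ω⟫) ∂P := by
            rw [integral_sub (hint k).integrableOn hI.integrableOn, hz, sub_zero]
        _ ≤ _ := by
            refine setIntegral_mono ((hint k).sub hI).integrableOn (hint (k + 1)).integrableOn
              fun ω => ?_
            have h1 := (hD k ω).norm_sub_apply_le (hD1 k ω) (e k ω)
            have h2 : ‖e k ω - D k ω (e k ω)‖ ^ 2 ≤ ‖e k ω‖ ^ 2 := by gcongr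
            simp only [hSdef, Finset.sum_range_succ, hrec k ω]
            rw [norm_add_sq_real, real_inner_smul_right, norm_smul, mul_pow, Real.norm_eq_abs,
              sq_abs]
            linarith
    refine hsub.exists_ae_tendsto_of_bdd (R := ((∑' j, a j ^ 2) * c + B).toNNReal) fun k => ?_
    rw [eLpNorm_one_eq_lintegral_enorm, ← ofReal_integral_norm_eq_lintegral_enorm (hint k)]
    refine ENNReal.ofReal_le_ofReal ?_
    calc ∫ ω, ‖S k ω - ‖e k ω‖ ^ 2‖ ∂P ≤ ∫ ω, (S k ω + ‖e k ω‖ ^ 2) ∂P := by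
          refine integral_mono (hint k).norm ((hSint k).add (heint k)) fun ω => ?_
          refine (norm_sub_le _ _).trans_eq ?_
          rw [Real.norm_of_nonneg (hS0 k ω), Real.norm_of_nonneg (by positivity)]
      _ ≤ _ := by
          rw [integral_add (hSint k) (heint k)]
          exact add_le_add (hSI k) (hB' k)
  have hmeas : TendstoInMeasure P (fun k ω => ‖e k ω‖ ^ 2) atTop (fun _ => (0 : ℝ)) := by
    refine tendstoInMeasure_of_tendsto_eLpNorm (p := 1) one_ne_zero
      (fun k => (heint k).1) aestronglyMeasurable_const ?_
    have : ∀ k, eLpNorm ((fun ω => ‖e k ω‖ ^ 2) - fun _ => (0 : ℝ)) 1 P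
        = ENNReal.ofReal (∫ ω, ‖e k ω‖ ^ 2 ∂P) := by
      intro k
      have h0 : ((fun ω => ‖e k ω‖ ^ 2) - fun _ => (0 : ℝ)) = fun ω => ‖e k ω‖ ^ 2 := by
        ext ω; simp
      rw [h0, eLpNorm_one_eq_lintegral_enorm, ← ofReal_integral_norm_eq_lintegral_enorm (heint k)]
      simp_rw [Real.norm_of_nonneg (sq_nonneg ‖e k _‖)]
    simp_rw [this]
    simpa using ENNReal.tendsto_ofReal hlim
  obtain ⟨ns, hns, hns0⟩ := hmeas.exists_seq_tendsto_ae
  filter_upwards [hconvS, hconvY, hns0] with ω ⟨l1, h1⟩ ⟨l2, h2⟩ h3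
  have h4 : Tendsto (fun k => ‖e k ω‖ ^ 2) atTop (nhds (l1 - l2)) := by
    simpa using h1.sub h2
  have h5 : l1 - l2 = 0 := tendsto_nhds_unique (h4.comp hns.tendsto_atTop) h3
  rw [h5] at h4
  simpa using h4.sqrt

end SecondMoments

section BlockComparison

variable {Ω E : Type*} [NormedAddCommGroup E] [InnerProductSpace ℝ E]
  {m0 : MeasurableSpace Ω} {P : Measure Ω}

lemma norm_sq_perturbed_step_le {d p x δ : E} {α w ε B : ℝ} (hε : 0 ≤ ε)
    (hε1 : ε ≤ 1) (hp : ‖p‖ ≤ ‖d‖) (hd : ‖d‖ ≤ 2 * B) (hx : ‖x‖ ≤ w * B) (hδ : ‖δ‖ ≤ ε * B) :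
    ‖p - α • x + δ‖ ^ 2
      ≤ ‖d‖ ^ 2 - 2 * α * ⟪p, x⟫ + (6 * ε + 2 * α ^ 2 * w ^ 2) * B ^ 2 := by
  have hB : 0 ≤ B := by linarith [norm_nonneg d]
  have e1 : p - α • x + δ = p + (δ - α • x) := by abel
  have e2 : ‖δ - α • x‖ ^ 2 ≤ 2 * (ε * B ^ 2) + 2 * (α ^ 2 * (w * B) ^ 2) := by
    have h1 : ‖δ - α • x‖ ≤ ‖δ‖ + ‖α • x‖ := norm_sub_le _ _
    have h2 : ‖α • x‖ ^ 2 ≤ α ^ 2 * (w * B) ^ 2 := by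
      rw [norm_smul, mul_pow, Real.norm_eq_abs, sq_abs]
      gcongr
    have h3 : ‖δ‖ ^ 2 ≤ ε * B ^ 2 := by
      calc ‖δ‖ ^ 2 ≤ (ε * B) ^ 2 := by gcongr
        _ = ε * (ε * B ^ 2) := by ring
        _ ≤ 1 * (ε * B ^ 2) := by gcongr
        _ = ε * B ^ 2 := one_mul _
    have h4 : ‖δ - α • x‖ ^ 2 ≤ (‖δ‖ + ‖α • x‖) ^ 2 := by gcongr
    nlinarith [sq_nonneg (‖δ‖ - ‖α • x‖)]
  have e3 : ⟪p, δ⟫ ≤ 2 * (ε * B ^ 2) := by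
    calc ⟪p, δ⟫ ≤ ‖p‖ * ‖δ‖ := real_inner_le_norm _ _
      _ ≤ (2 * B) * (ε * B) := by
        gcongr; exact hp.trans hd
      _ = 2 * (ε * B ^ 2) := by ring
  have e4 : ‖p‖ ^ 2 ≤ ‖d‖ ^ 2 := by gcongr
  rw [e1, norm_add_sq_real, inner_sub_right, real_inner_smul_right]
  nlinarith

/-- Comparison of a perturbed iteration with the iteration of `1 - α Q`, when the perturbation has
a part which is centred in conditional mean and a summable part. -/
lemma integral_norm_sq_sub_propagator_le {F : ℕ → MeasurableSpace Ω} (hFm : ∀ k, F k ≤ m0)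
    (hF0 : ∀ k, F 0 ≤ F k) {U : ℕ → Ω → E} (hU : ∀ k, StronglyMeasurable[F k] (U k))
    {B : Ω → ℝ} (hB : MemLp B 2 P) (hUB : ∀ k ω, ‖U k ω‖ ≤ B ω)
    {Q : E →L[ℝ] E} (hQ : Q.IsPositive) {α : ℕ → ℝ} (hα : ∀ k, 0 ≤ α k)
    (hα1 : ∀ k, ‖α k • Q‖ ≤ 1)
    {W : ℕ → Ω → E →L[ℝ] E} (hWm : ∀ k, StronglyMeasurable[m0] (W k)) {w : ℝ}
    (hw : 0 ≤ w) (hW : ∀ k, ∀ᵐ ω ∂P, ‖W k ω‖ ≤ w)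
    (hW0 : ∀ k (p q : Ω → E), StronglyMeasurable[F k] p → StronglyMeasurable[F k] q →
      MemLp p 2 P → MemLp q 2 P → ∫ ω, ⟪p ω, W k ω (q ω)⟫ ∂P = 0)
    {ε : ℕ → ℝ} (hε : ∀ k, 0 ≤ ε k) (hε1 : ∀ k, ε k ≤ 1)
    (hstep : ∀ k, ∀ᵐ ω ∂P,
      ‖U (k + 1) ω - (U k ω - α k • Q (U k ω) - α k • W k ω (U k ω))‖ ≤ ε k * B ω) (k : ℕ) :
    ∫ ω, ‖U k ω - propagator (fun l => α l • Q) k (U 0 ω)‖ ^ 2 ∂P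
      ≤ (∑ l ∈ Finset.range k, (6 * ε l + 2 * α l ^ 2 * w ^ 2)) * ∫ ω, B ω ^ 2 ∂P := by
  have hpos : ∀ k, (α k • Q).IsPositive := fun k => hQ.smul_of_nonneg (hα k)
  have hUL : ∀ k, MemLp (U k) 2 P := fun k =>
    hB.mono ((hU k).mono (hFm k)).aestronglyMeasurable
      (ae_of_all _ fun ω => (hUB k ω).trans (le_abs_self _))
  have hBint : Integrable (fun ω => B ω ^ 2) P := hB.integrable_sq
  set d : ℕ → Ω → E := fun k ω => U k ω - propagator (fun l => α l • Q) k (U 0 ω) with hd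
  have hdm : ∀ k, StronglyMeasurable[F k] (d k) := fun k =>
    (hU k).sub ((propagator (fun l => α l • Q) k).continuous.comp_stronglyMeasurable
      ((hU 0).mono (hF0 k)))
  have hdB : ∀ k ω, ‖d k ω‖ ≤ 2 * B ω := fun k ω => by
    have h1 := (norm_propagator_apply_le hpos hα1 k (U 0 ω)).trans (hUB 0 ω)
    have h2 := norm_sub_le (U k ω) (propagator (fun l => α l • Q) k (U 0 ω))
    have h3 := hUB k ω
    simp only [hd]
    linarith
  have hdL : ∀ k, MemLp (d k) 2 P := fun k =>
    (hB.const_mul 2).mono ((hdm k).mono (hFm k)).aestronglyMeasurable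
      (ae_of_all _ fun ω => (hdB k ω).trans (le_abs_self _))
  induction k with
  | zero => simp
  | succ k ih =>
    have hpm : StronglyMeasurable[F k] fun ω => d k ω - (α k • Q) (d k ω) :=
      (hdm k).sub ((α k • Q).continuous.comp_stronglyMeasurable (hdm k))
    have hple : ∀ ω, ‖d k ω - (α k • Q) (d k ω)‖ ≤ ‖d k ω‖ :=
      fun ω => (hpos k).norm_sub_apply_le (hα1 k) _
    have hpL : MemLp (fun ω => d k ω - (α k • Q) (d k ω)) 2 P :=
      (hdL k).mono (hpm.mono (hFm k)).aestronglyMeasurable (ae_of_all _ hple)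
    have hWL : MemLp (fun ω => W k ω (U k ω)) 2 P :=
      (hUL k).of_le_mul (c := w)
        ((hWm k).opApply ((hU k).mono (hFm k))).aestronglyMeasurable <| by
          filter_upwards [hW k] with ω hω using (W k ω).le_of_opNorm_le hω _
    have i1 := (hdL k).integrable_norm_pow two_ne_zero
    have i2 := (hpL.integrable_inner_of_two hWL).const_mul (2 * α k)
    have i3 := hBint.const_mul (6 * ε k + 2 * α k ^ 2 * w ^ 2)
    have i12 : Integrable (fun ω => ‖d k ω‖ ^ 2
        - 2 * α k * ⟪d k ω - (α k • Q) (d k ω), W k ω (U k ω)⟫) P := i1.sub i2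
    have hle : ∀ᵐ ω ∂P, ‖d (k + 1) ω‖ ^ 2 ≤ ‖d k ω‖ ^ 2
        - 2 * α k * ⟪d k ω - (α k • Q) (d k ω), W k ω (U k ω)⟫
        + (6 * ε k + 2 * α k ^ 2 * w ^ 2) * B ω ^ 2 := by
      filter_upwards [hstep k, hW k] with ω h1 h2
      have e1 : d (k + 1) ω = (d k ω - (α k • Q) (d k ω)) - α k • W k ω (U k ω)
          + (U (k + 1) ω - (U k ω - α k • Q (U k ω) - α k • W k ω (U k ω))) := by
        simp only [hd, propagator_succ, map_sub, smul_apply]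
        abel
      rw [e1]
      refine norm_sq_perturbed_step_le (hε k) (hε1 k) (hple ω) (hdB k ω) ?_ h1
      refine ((W k ω).le_of_opNorm_le h2 _).trans ?_
      gcongr
      exact hUB k ω
    calc ∫ ω, ‖d (k + 1) ω‖ ^ 2 ∂P
        ≤ ∫ ω, (‖d k ω‖ ^ 2
            - 2 * α k * ⟪d k ω - (α k • Q) (d k ω), W k ω (U k ω)⟫
            + (6 * ε k + 2 * α k ^ 2 * w ^ 2) * B ω ^ 2) ∂P :=
          integral_mono_ae ((hdL (k + 1)).integrable_norm_pow two_ne_zero) (i12.add i3) hle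
      _ = ∫ ω, ‖d k ω‖ ^ 2 ∂P + (6 * ε k + 2 * α k ^ 2 * w ^ 2) * ∫ ω, B ω ^ 2 ∂P := by
          rw [integral_add i12 i3, integral_sub i1 i2, integral_const_mul, integral_const_mul,
            hW0 k _ _ hpm (hU k) hpL (hUL k), mul_zero, sub_zero]
      _ ≤ _ := by
          rw [Finset.sum_range_succ, add_mul (Finset.sum _ _)]
          exact add_le_add ih le_rfl

variable [CompleteSpace E]

lemma tendsto_integral_norm_sq_propagator {Q : E →L[ℝ] E} (hQ : Q.IsPositive)
    (hQ0 : ∀ x, x ≠ 0 → 0 < ⟪Q x, x⟫) {α : ℕ → ℝ} (hα : ∀ k, 0 ≤ α k)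
    (hα1 : ∀ k, ‖α k • Q‖ ≤ 1) (hαs : ¬ Summable α) {x : Ω → E} (hx : MemLp x 2 P) :
    Tendsto (fun k => ∫ ω, ‖propagator (fun l => α l • Q) k (x ω)‖ ^ 2 ∂P) atTop (nhds 0) := by
  have hpos : ∀ k, (α k • Q).IsPositive := fun k => hQ.smul_of_nonneg (hα k)
  have := tendsto_integral_of_dominated_convergence (μ := P)
    (F := fun k ω => ‖propagator (fun l => α l • Q) k (x ω)‖ ^ 2) (f := fun _ => (0 : ℝ))
    (fun ω => ‖x ω‖ ^ 2)
    (fun k => (((propagator (fun l => α l • Q) k).continuous.comp_aestronglyMeasurable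
      hx.1).norm.pow 2)) (hx.integrable_norm_pow two_ne_zero)
    (fun k => ae_of_all _ fun ω => by
      rw [Real.norm_of_nonneg (by positivity)]
      have := norm_propagator_apply_le hpos hα1 k (x ω)
      gcongr)
    (ae_of_all _ fun ω => by
      simpa using (tendsto_propagator_smul_zero hQ hQ0 hα hα1 hαs (x ω)).norm.pow 2)
  simpa using this

variable [IsProbabilityMeasure P]

/-- Mean square estimate along blocks of length `h` for products of positive contractions
`1 - (a T + b L)` driven by a martingale difference noise, when the conditional means of the block
sums of `T` are close to a fixed operator. -/
lemma exists_integral_norm_sq_le {F G : ℕ → MeasurableSpace Ω} (hF : Monotone F)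
    (hFG : ∀ k, F k ≤ G k) (hG : ∀ k, G k ≤ m0)
    {T : ℕ → Ω → E →L[ℝ] E} {L : E →L[ℝ] E}
    (hTF : ∀ l, StronglyMeasurable[F (l + 1)] (T l)) (hTG : ∀ l, StronglyMeasurable[G l] (T l))
    (hT : ∀ l ω, (T l ω).IsPositive) (hL : L.IsPositive) {κ lam : ℝ}
    (hTκ : ∀ l ω, ‖T l ω‖ ≤ κ) (hLlam : ‖L‖ ≤ lam)
    {a b : ℕ → ℝ} (ha : ∀ l, 0 ≤ a l) (hb : ∀ l, 0 ≤ b l)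
    (hd1 : ∀ l, a l * κ + b l * lam ≤ 1) (ha2 : Summable fun l => a l ^ 2)
    {n e : ℕ → Ω → E} {c : ℝ} (hnm : ∀ l, StronglyMeasurable[F (l + 1)] (n l))
    (hn2 : ∀ l, MemLp (n l) 2 P)
    (hn : ∀ l, MeanOrthogonal (G l) P (n l)) (hnc : ∀ l, ∫ ω, ‖n l ω‖ ^ 2 ∂P ≤ c)
    (he0 : StronglyMeasurable[F 0] (e 0)) (he02 : MemLp (e 0) 2 P)
    (hrec : ∀ l ω, e (l + 1) ω = e l ω - (a l • T l ω + b l • L) (e l ω) + a l • n l ω)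
    {h : ℕ} {Nop : E →L[ℝ] E} {α : ℕ → ℝ} (hα : ∀ k, 0 ≤ α k)
    (hQ : (Nop + (h : ℝ) • L).IsPositive)
    (hQ0 : ∀ x, x ≠ 0 → 0 < ⟪(Nop + (h : ℝ) • L) x, x⟫)
    (hα1 : ∀ k, ‖α k • (Nop + (h : ℝ) • L)‖ ≤ 1) (hαs : ¬ Summable α)
    {ρ : ℕ → ℝ} (haρ : ∀ k, ∀ l < h, |a (k * h + l) - α k| ≤ ρ k)
    (hbρ : ∀ k, ∀ l < h, |b (k * h + l) - α k| ≤ ρ k)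
    {R : ℕ → Ω → E →L[ℝ] E} (hRm : ∀ k, StronglyMeasurable[m0] (R k)) {r : ℕ → ℝ} {rbar : ℝ}
    (hR : ∀ k, ∀ᵐ ω ∂P, ‖R k ω - Nop‖ ≤ r k) (hr : ∀ k, r k ≤ rbar) (hrbar : 0 ≤ rbar)
    (hR0 : ∀ k (p q : Ω → E), StronglyMeasurable[F (k * h)] p → StronglyMeasurable[F (k * h)] q →
      MemLp p 2 P → MemLp q 2 P →
        ∫ ω, ⟪p ω, (∑ l ∈ Finset.range h, T (k * h + l) ω - R k ω) (q ω)⟫ ∂P = 0)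
    {ε : ℕ → ℝ} (hε1 : ∀ k, ε k ≤ 1) (hε0 : ∀ k, 0 ≤ ε k)
    (hε : ∀ k, (∑ l ∈ Finset.range h, (a (k * h + l) * κ + b (k * h + l) * lam)) ^ 2
      + h * (ρ k * (κ + lam)) + α k * r k ≤ ε k)
    (hcs : Summable fun k => 6 * ε k + 2 * α k ^ 2 * (h * κ + ‖Nop‖ + rbar) ^ 2)
    {δ : ℝ} (hδ : 0 < δ) :
    ∃ k, ∫ ω, ‖e (k * h) ω‖ ^ 2 ∂P ≤ 2 * (c * ∑' l, a l ^ 2)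
      + 4 * ((∑' k, (6 * ε k + 2 * α k ^ 2 * (h * κ + ‖Nop‖ + rbar) ^ 2))
          * ∫ ω, ‖e 0 ω‖ ^ 2 ∂P) + δ := by
  have hFm : ∀ k, F k ≤ m0 := fun k => (hFG k).trans (hG k)
  set D : ℕ → Ω → E →L[ℝ] E := fun l ω => a l • T l ω + b l • L with hDdef
  have hD : ∀ l ω, (D l ω).IsPositive := fun l ω =>
    ((hT l ω).smul_of_nonneg (ha l)).add (hL.smul_of_nonneg (hb l))
  have hD1 : ∀ l ω, ‖D l ω‖ ≤ 1 := fun l ω => by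
    refine (norm_add_le _ _).trans ((add_le_add ?_ ?_).trans (hd1 l))
    · rw [norm_smul, Real.norm_of_nonneg (ha l)]
      exact mul_le_mul_of_nonneg_left (hTκ l ω) (ha l)
    · rw [norm_smul, Real.norm_of_nonneg (hb l)]
      exact mul_le_mul_of_nonneg_left hLlam (hb l)
  have hDF : ∀ l, StronglyMeasurable[F (l + 1)] (D l) := fun l =>
    ((hTF l).const_smul (a l)).add stronglyMeasurable_const
  have hDG : ∀ l, StronglyMeasurable[G l] (D l) := fun l =>
    ((hTG l).const_smul (a l)).add stronglyMeasurable_const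
  have hem : ∀ l, StronglyMeasurable[F l] (e l) := by
    intro l
    induction l with
    | zero => exact he0
    | succ l ih =>
      rw [funext (hrec l)]
      exact ((ih.mono (hF l.le_succ)).subOpApply (hDF l)).add ((hnm l).const_smul (a l))
  have heL : ∀ l, MemLp (e l) 2 P := by
    intro l
    induction l with
    | zero => exact he02
    | succ l ih =>
      have := (ih.contraction (hG l) ((hem l).mono (hFG l)) (hDG l) (hD l) (hD1 l)).add
        ((hn2 l).const_smul (a l))
      exact this.ae_eq (ae_of_all _ fun ω => (hrec l ω).symm)
  set u : ℕ → Ω → E := fun l ω => propagator (fun j => D j ω) l (e 0 ω) with hu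
  have hum : ∀ l, StronglyMeasurable[F l] (u l) := by
    intro l
    induction l with
    | zero => exact he0
    | succ l ih => exact (ih.mono (hF l.le_succ)).subOpApply (hDF l)
  have hule : ∀ l ω, ‖u l ω‖ ≤ ‖e 0 ω‖ := fun l ω =>
    norm_propagator_apply_le (fun j => hD j ω) (fun j => hD1 j ω) l _
  have huL : ∀ l, MemLp (u l) 2 P := fun l =>
    he02.mono ((hum l).mono (hFm l)).aestronglyMeasurable (ae_of_all _ (hule l))
  have hwI : ∀ l, ∫ ω, ‖e l ω - u l ω‖ ^ 2 ∂P ≤ ∑ j ∈ Finset.range l, a j ^ 2 * c := by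
    intro l
    induction l with
    | zero => simp [hu]
    | succ l ih =>
      have h1 := integral_norm_sq_contraction_add_noise_le (hG l)
        (((hem l).sub (hum l)).mono (hFG l)) ((heL l).sub (huL l)) (hDG l) (hD l) (hD1 l) (hn2 l)
        (hn l) (a l)
      have e1 : ∀ ω, e (l + 1) ω - u (l + 1) ω
          = (e l - u l) ω - D l ω ((e l - u l) ω) + a l • n l ω := by
        intro ω
        simp only [hu, propagator_succ, hrec l ω, Pi.sub_apply, map_sub]
        abel
      simp_rw [e1]
      rw [Finset.sum_range_succ]
      refine h1.trans (add_le_add ih ?_)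
      exact mul_le_mul_of_nonneg_left (hnc l) (sq_nonneg _)
  have hblock : ∀ k, ∀ᵐ ω ∂P, ‖u ((k + 1) * h) ω
      - (u (k * h) ω - α k • (Nop + (h : ℝ) • L) (u (k * h) ω)
        - α k • (∑ l ∈ Finset.range h, T (k * h + l) ω - R k ω) (u (k * h) ω))‖
      ≤ ε k * ‖e 0 ω‖ := by
    intro k
    filter_upwards [hR k] with ω hω
    have e1 : u ((k + 1) * h) ω
        = propagator (fun l => a (k * h + l) • T (k * h + l) ω + b (k * h + l) • L) h
            (u (k * h) ω) := by
      simp only [hu, add_mul, one_mul, propagator_add, hDdef]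
    have h1 := norm_propagator_sub_frozen_le (fun l => hT (k * h + l) ω) hL
      (fun l => hTκ (k * h + l) ω) hLlam (fun l => ha (k * h + l)) (fun l => hb (k * h + l))
      (fun l => hd1 (k * h + l)) (haρ k) (hbρ k) (u (k * h) ω)
    have h2 : ‖α k • (R k ω - Nop) (u (k * h) ω)‖ ≤ α k * r k * ‖u (k * h) ω‖ := by
      rw [norm_smul, Real.norm_of_nonneg (hα k), mul_assoc]
      exact mul_le_mul_of_nonneg_left ((R k ω - Nop).le_of_opNorm_le hω _) (hα k)
    have e2 : u ((k + 1) * h) ω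
      - (u (k * h) ω - α k • (Nop + (h : ℝ) • L) (u (k * h) ω)
        - α k • (∑ l ∈ Finset.range h, T (k * h + l) ω - R k ω) (u (k * h) ω))
      = (propagator (fun l => a (k * h + l) • T (k * h + l) ω + b (k * h + l) • L) h
            (u (k * h) ω) - (u (k * h) ω
              - α k • ((∑ l ∈ Finset.range h, T (k * h + l) ω + (h : ℝ) • L) (u (k * h) ω))))
        - α k • (R k ω - Nop) (u (k * h) ω) := by
      rw [e1]
      simp only [add_apply, sub_apply]
      module
    rw [e2]
    refine (norm_sub_le _ _).trans ((add_le_add h1 h2).trans ?_)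
    rw [← add_mul]
    exact mul_le_mul (hε k) (hule _ ω) (norm_nonneg _) (hε0 k)
  have hκ0 : 0 ≤ κ := by
    obtain ⟨ω⟩ : Nonempty Ω := nonempty_of_isProbabilityMeasure P
    exact (norm_nonneg _).trans (hTκ 0 ω)
  have hcomp := integral_norm_sq_sub_propagator_le (fun k => hFm (k * h))
    (fun k => hF (Nat.mul_le_mul_right h (Nat.zero_le k))) (fun k => hum (k * h)) he02.norm
    (fun k => hule (k * h)) hQ hα hα1
    (W := fun k ω => ∑ l ∈ Finset.range h, T (k * h + l) ω - R k ω)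
    (fun k => (Finset.stronglyMeasurable_fun_sum _
      fun l _ => (hTG (k * h + l)).mono (hG _)).sub (hRm k))
    (w := h * κ + ‖Nop‖ + rbar) (by positivity)
    (fun k => by
      filter_upwards [hR k] with ω hω
      have h1 : ‖∑ l ∈ Finset.range h, T (k * h + l) ω‖ ≤ h * κ :=
        (norm_sum_le_of_le _ fun l _ => hTκ (k * h + l) ω).trans (by simp)
      have h2 : ‖R k ω‖ ≤ ‖R k ω - Nop‖ + ‖Nop‖ := norm_le_norm_sub_add _ _
      have h3 := norm_sub_le (∑ l ∈ Finset.range h, T (k * h + l) ω) (R k ω)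
      linarith [hr k])
    hR0 hε0 hε1 hblock
  have hZ := tendsto_integral_norm_sq_propagator hQ hQ0 hα hα1 hαs he02
  obtain ⟨k, hk⟩ := (hZ.eventually (gt_mem_nhds (show (0 : ℝ) < δ / 4 by positivity))).exists
  refine ⟨k, ?_⟩
  have hZL : MemLp (fun ω => propagator (fun l => α l • (Nop + (h : ℝ) • L)) k (e 0 ω)) 2 P :=
    he02.mono ((propagator _ k).continuous.comp_aestronglyMeasurable he02.1) <|
      ae_of_all _ fun ω =>
        norm_propagator_apply_le (fun l => hQ.smul_of_nonneg (hα l)) hα1 k _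
  have hc1 := hcomp k
  have s1 := integral_norm_sq_add_le ((huL (k * h)).sub hZL) hZL
  have s2 := integral_norm_sq_add_le ((heL (k * h)).sub (huL (k * h))) (huL (k * h))
  simp only [Pi.sub_apply, sub_add_cancel] at s1 s2
  have hc0 : 0 ≤ c := (integral_nonneg fun ω => by positivity).trans (hnc 0)
  have t1 : ∑ j ∈ Finset.range (k * h), a j ^ 2 * c ≤ c * ∑' l, a l ^ 2 := by
    rw [← Finset.sum_mul, mul_comm c]
    exact mul_le_mul_of_nonneg_right (ha2.sum_le_tsum _ fun _ _ => sq_nonneg _) hc0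
  have t2 : (∑ l ∈ Finset.range k, (6 * ε l + 2 * α l ^ 2 * (h * κ + ‖Nop‖ + rbar) ^ 2))
      * ∫ ω, ‖e 0 ω‖ ^ 2 ∂P ≤ (∑' k, (6 * ε k + 2 * α k ^ 2 * (h * κ + ‖Nop‖ + rbar) ^ 2))
          * ∫ ω, ‖e 0 ω‖ ^ 2 ∂P := by
    gcongr
    exact hcs.sum_le_tsum _ fun l _ => by have := hε0 l; positivity
  have t3 := hwI (k * h)
  simp only [zero_mul, hu, propagator_zero] at hc1 s1 s2 t3
  linarith

end BlockComparison

section Gains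

lemma Summable.sum_block {g : ℕ → ℝ} (hg : Summable g) {h : ℕ} (hh : 0 < h) :
    Summable fun k => ∑ l ∈ Finset.range h, g (k * h + l) :=
  summable_sum fun _ _ => hg.comp_injective fun _ _ hij =>
    Nat.eq_of_mul_eq_mul_right hh (Nat.add_right_cancel hij)

lemma not_summable_block {a : ℕ → ℝ} (ha : ∀ k, 0 ≤ a k) (hanti : Antitone a)
    (has : ¬ Summable a) {h : ℕ} (hh : 0 < h) : ¬ Summable fun k => a (k * h) := by
  intro hs
  have key : ∀ k, ∑ i ∈ Finset.range (k * h), a i ≤ h * ∑ j ∈ Finset.range k, a (j * h) := by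
    intro k
    induction k with
    | zero => simp
    | succ k ih =>
      rw [add_mul, one_mul, Finset.sum_range_add, Finset.sum_range_succ, mul_add]
      refine add_le_add ih ?_
      calc ∑ l ∈ Finset.range h, a (k * h + l) ≤ ∑ l ∈ Finset.range h, a (k * h) :=
            Finset.sum_le_sum fun l _ => hanti (Nat.le_add_right _ _)
        _ = h * a (k * h) := by simp
  refine has (summable_of_sum_range_le (c := h * ∑' j, a (j * h)) ha fun k => ?_)
  calc ∑ i ∈ Finset.range k, a i ≤ ∑ i ∈ Finset.range (k * h), a i :=
        Finset.sum_le_sum_of_subset_of_nonneg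
          (Finset.range_mono (Nat.le_mul_of_pos_right k hh)) fun i _ _ => ha i
    _ ≤ _ := (key k).trans (mul_le_mul_of_nonneg_left
        (hs.sum_le_tsum _ fun j _ => ha _) (Nat.cast_nonneg _))

variable {a b : ℕ → ℝ} {C : ℝ} {h : ℕ}

lemma abs_sub_block_start_le (hanti : Antitone a)
    (hC : ∀ k, max (a k - a (k + 1)) |b k - a k| ≤ C * (a k ^ 2 + b k ^ 2)) (hC0 : 0 ≤ C)
    (k : ℕ) {l : ℕ} (hl : l < h) :
    |a (k * h + l) - a (k * h)|
      ≤ C * ∑ j ∈ Finset.range h, (a (k * h + j) ^ 2 + b (k * h + j) ^ 2) := by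
  rw [abs_sub_comm, abs_of_nonneg (sub_nonneg.2 (hanti (Nat.le_add_right _ _)))]
  have e := Finset.sum_range_sub' (fun j => a (k * h + j)) l
  simp only [add_zero] at e
  rw [← e, Finset.mul_sum]
  refine (Finset.sum_le_sum fun j _ => (le_max_left _ _).trans (hC (k * h + j))).trans ?_
  exact Finset.sum_le_sum_of_subset_of_nonneg (Finset.range_mono hl.le)
    fun j _ _ => by positivity

lemma abs_sub_block_start_le' (hanti : Antitone a)
    (hC : ∀ k, max (a k - a (k + 1)) |b k - a k| ≤ C * (a k ^ 2 + b k ^ 2)) (hC0 : 0 ≤ C)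
    (k : ℕ) {l : ℕ} (hl : l < h) :
    |b (k * h + l) - a (k * h)|
      ≤ 2 * C * ∑ j ∈ Finset.range h, (a (k * h + j) ^ 2 + b (k * h + j) ^ 2) := by
  have h1 := abs_sub_block_start_le hanti hC hC0 k hl
  have h2 := (le_max_right _ _).trans (hC (k * h + l))
  have h3 : C * (a (k * h + l) ^ 2 + b (k * h + l) ^ 2)
      ≤ C * ∑ j ∈ Finset.range h, (a (k * h + j) ^ 2 + b (k * h + j) ^ 2) :=
    mul_le_mul_of_nonneg_left (Finset.single_le_sum
      (f := fun j => a (k * h + j) ^ 2 + b (k * h + j) ^ 2)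
      (fun j _ => by positivity) (Finset.mem_range.2 hl)) hC0
  have h4 := abs_sub_le (b (k * h + l)) (a (k * h + l)) (a (k * h))
  linarith

lemma sq_sum_gain_le (κ lam : ℝ) (k : ℕ) :
    (∑ l ∈ Finset.range h, (a (k * h + l) * κ + b (k * h + l) * lam)) ^ 2
      ≤ h * (κ ^ 2 + lam ^ 2)
        * ∑ j ∈ Finset.range h, (a (k * h + j) ^ 2 + b (k * h + j) ^ 2) := by
  refine sq_sum_le_card_mul_sum_sq.trans ?_
  rw [Finset.card_range, mul_assoc, Finset.mul_sum (Finset.range h) _ (κ ^ 2 + lam ^ 2)]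
  gcongr with l _
  nlinarith [sq_nonneg (a (k * h + l) * lam - b (k * h + l) * κ)]

end Gains

section Consistency

variable {Ω E : Type*} [NormedAddCommGroup E] [InnerProductSpace ℝ E]
  {m0 : MeasurableSpace Ω} {P : Measure Ω} [CompleteSpace E] [IsProbabilityMeasure P]

/-- Mean square and almost sure convergence to zero of a recursion
`e (l + 1) = e l - (a T + b L) e l + a n` with positive random operators `T`, a positive operator
`L` and a martingale difference noise `n`, under a conditional excitation condition along blocks
of length `h`. -/
theorem tendsto_zero_of_block_excitation {F : ℕ → MeasurableSpace Ω} (hF : Monotone F)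
    {G : Filtration ℕ m0} (hFG : ∀ k, F k ≤ G k)
    {T : ℕ → Ω → E →L[ℝ] E} {L : E →L[ℝ] E}
    (hTF : ∀ l, StronglyMeasurable[F (l + 1)] (T l)) (hTG : ∀ l, StronglyMeasurable[G l] (T l))
    (hT : ∀ l ω, (T l ω).IsPositive) (hL : L.IsPositive) {κ : ℝ}
    (hTκ : ∀ l ω, ‖T l ω‖ ≤ κ)
    {a b : ℕ → ℝ} (ha : ∀ l, 0 ≤ a l) (hb : ∀ l, 0 ≤ b l) (hanti : Antitone a)
    (ha2 : Summable fun l => a l ^ 2) (hb2 : Summable fun l => b l ^ 2) (has : ¬ Summable a)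
    {C : ℝ} (hC0 : 0 ≤ C)
    (hC : ∀ k, max (a k - a (k + 1)) |b k - a k| ≤ C * (a k ^ 2 + b k ^ 2))
    {n e : ℕ → Ω → E} {c : ℝ} (hnm : ∀ l, StronglyMeasurable[F (l + 1)] (n l))
    (hn2 : ∀ l, MemLp (n l) 2 P)
    (hn : ∀ l, MeanOrthogonal (G l) P (n l)) (hnc : ∀ l, ∫ ω, ‖n l ω‖ ^ 2 ∂P ≤ c)
    (he0 : StronglyMeasurable[F 0] (e 0)) (he02 : MemLp (e 0) 2 P)
    (hrec : ∀ l ω, e (l + 1) ω = e l ω - (a l • T l ω + b l • L) (e l ω) + a l • n l ω)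
    {h : ℕ} (hh : 0 < h) {Nop : E →L[ℝ] E}
    (hQ : (Nop + (h : ℝ) • L).IsPositive)
    (hQ0 : ∀ x, x ≠ 0 → 0 < ⟪(Nop + (h : ℝ) • L) x, x⟫)
    {R : ℕ → Ω → E →L[ℝ] E} (hRm : ∀ k, StronglyMeasurable[m0] (R k)) {r : ℕ → ℝ}
    (hr2 : Summable fun k => r k ^ 2) (hR : ∀ k, ∀ᵐ ω ∂P, ‖R k ω - Nop‖ ≤ r k)
    (hR0 : ∀ k (p q : Ω → E), StronglyMeasurable[F (k * h)] p → StronglyMeasurable[F (k * h)] q →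
      MemLp p 2 P → MemLp q 2 P →
        ∫ ω, ⟪p ω, (∑ l ∈ Finset.range h, T (k * h + l) ω - R k ω) (q ω)⟫ ∂P = 0) :
    (∀ l, MemLp (e l) 2 P) ∧ Tendsto (fun l => ∫ ω, ‖e l ω‖ ^ 2 ∂P) atTop (nhds 0) ∧
      ∀ᵐ ω ∂P, Tendsto (fun l => ‖e l ω‖) atTop (nhds 0) := by
  have hκ0 : 0 ≤ κ := by
    obtain ⟨ω⟩ : Nonempty Ω := nonempty_of_isProbabilityMeasure P
    exact (norm_nonneg _).trans (hTκ 0 ω)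
  have hc0 : 0 ≤ c := (integral_nonneg fun ω => by positivity).trans (hnc 0)
  have sq_lim : ∀ {u : ℕ → ℝ}, (∀ l, 0 ≤ u l) → (Summable fun l => u l ^ 2) →
      Tendsto u atTop (nhds 0) := fun {u} hu hs => by
    have := hs.tendsto_atTop_zero.sqrt
    simpa [Real.sqrt_sq (hu _)] using this
  have ha0 := sq_lim ha ha2
  have hb0 := sq_lim hb hb2
  set D : ℕ → Ω → E →L[ℝ] E := fun l ω => a l • T l ω + b l • L with hDdef
  have hD : ∀ l ω, (D l ω).IsPositive := fun l ω =>
    ((hT l ω).smul_of_nonneg (ha l)).add (hL.smul_of_nonneg (hb l))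
  have hDle : ∀ l ω, ‖D l ω‖ ≤ a l * κ + b l * ‖L‖ := fun l ω => by
    refine (norm_add_le _ _).trans (add_le_add ?_ ?_)
    · rw [norm_smul, Real.norm_of_nonneg (ha l)]
      exact mul_le_mul_of_nonneg_left (hTκ l ω) (ha l)
    · rw [norm_smul, Real.norm_of_nonneg (hb l)]
  have hDF : ∀ l, StronglyMeasurable[F (l + 1)] (D l) := fun l =>
    ((hTF l).const_smul (a l)).add stronglyMeasurable_const
  have hDG : ∀ l, StronglyMeasurable[G l] (D l) := fun l =>
    ((hTG l).const_smul (a l)).add stronglyMeasurable_const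
  have hem : ∀ l, StronglyMeasurable[F l] (e l) := by
    intro l
    induction l with
    | zero => exact he0
    | succ l ih =>
      rw [funext (hrec l)]
      exact ((ih.mono (hF l.le_succ)).subOpApply (hDF l)).add ((hnm l).const_smul (a l))
  have heG : ∀ l, StronglyMeasurable[G l] (e l) := fun l => (hem l).mono (hFG l)
  have heL : ∀ l, MemLp (e l) 2 P := by
    intro l
    induction l with
    | zero => exact he02
    | succ l ih =>
      rw [funext (hrec l)]
      refine (ih.sub (ih.of_le_mul (c := a l * κ + b l * ‖L‖)
        (((hDG l).opApply (heG l)).mono (G.le l)).aestronglyMeasurable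
        (ae_of_all _ fun ω => ?_))).add ((hn2 l).const_smul (a l))
      exact (D l ω).le_of_opNorm_le (hDle l ω) _
  obtain ⟨k0, hk0⟩ : ∃ k0, ∀ l ≥ k0, a l * κ + b l * ‖L‖ ≤ 1 := by
    have h1 : Tendsto (fun l => a l * κ + b l * ‖L‖) atTop (nhds 0) := by
      simpa using (ha0.mul_const κ).add (hb0.mul_const ‖L‖)
    exact eventually_atTop.1 (h1.eventually (ge_mem_nhds one_pos))
  have hV : ∀ l ≥ k0, ∀ j, ∫ ω, ‖e (l + j) ω‖ ^ 2 ∂P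
      ≤ ∫ ω, ‖e l ω‖ ^ 2 ∂P + c * ∑' i, a (i + l) ^ 2 := by
    intro l hl j
    have hsum : Summable fun i => a (l + i) ^ 2 := by
      simpa only [add_comm l] using (summable_nat_add_iff (f := fun i => a i ^ 2) l).2 ha2
    have h1 : ∫ ω, ‖e (l + j) ω‖ ^ 2 ∂P
        ≤ ∫ ω, ‖e l ω‖ ^ 2 ∂P + c * ∑ i ∈ Finset.range j, a (l + i) ^ 2 := by
      induction j with
      | zero => simp
      | succ j ih =>
        have h2 := integral_norm_sq_contraction_add_noise_le (G.le (l + j)) (heG (l + j))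
          (heL (l + j)) (hDG (l + j)) (hD (l + j))
          (fun ω => (hDle (l + j) ω).trans (hk0 _ (by lia))) (hn2 (l + j)) (hn (l + j)) (a (l + j))
        rw [← add_assoc, Finset.sum_range_succ]
        simp_rw [hrec (l + j)]
        have h3 := mul_le_mul_of_nonneg_left (hnc (l + j)) (sq_nonneg (a (l + j)))
        linarith
    refine h1.trans (add_le_add le_rfl (mul_le_mul_of_nonneg_left ?_ hc0))
    simp_rw [add_comm _ l]
    exact hsum.sum_le_tsum _ fun _ _ => sq_nonneg _
  set q : ℕ → ℝ := fun k => ∑ l ∈ Finset.range h, (a (k * h + l) ^ 2 + b (k * h + l) ^ 2) with hq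
  have hqs : Summable q := (ha2.add hb2).sum_block hh
  have hq0 : ∀ k, 0 ≤ q k := fun k => Finset.sum_nonneg fun l _ => by positivity
  set ρ : ℕ → ℝ := fun k => 2 * C * q k with hρ
  have hαs2 : Summable fun k => a (k * h) ^ 2 := by
    refine ha2.comp_injective (i := fun k => k * h) fun i j hij => ?_
    exact Nat.eq_of_mul_eq_mul_right hh hij
  set ε : ℕ → ℝ := fun k => h * (κ ^ 2 + ‖L‖ ^ 2) * q k + h * (ρ k * (κ + ‖L‖))
    + (a (k * h) ^ 2 + r k ^ 2) with hεdef
  have hε0 : ∀ k, 0 ≤ ε k := fun k => by have := hq0 k; positivity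
  have hεs : Summable ε :=
    ((hqs.mul_left _).add (((hqs.mul_left (2 * C)).mul_right _).mul_left _)).add (hαs2.add hr2)
  have hε : ∀ k, (∑ l ∈ Finset.range h, (a (k * h + l) * κ + b (k * h + l) * ‖L‖)) ^ 2
      + h * (ρ k * (κ + ‖L‖)) + a (k * h) * r k ≤ ε k := fun k => by
    have h1 := sq_sum_gain_le (a := a) (b := b) (h := h) κ ‖L‖ k
    have h2 : a (k * h) * r k ≤ a (k * h) ^ 2 + r k ^ 2 := by
      nlinarith [sq_nonneg (a (k * h) - r k), sq_nonneg (a (k * h)), sq_nonneg (r k)]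
    simp only [hεdef, hq]
    linarith
  set rbar : ℝ := 1 + ∑' k, r k ^ 2 with hrbar
  have hrle : ∀ k, r k ≤ rbar := fun k => by
    have := hr2.le_tsum k fun _ _ => sq_nonneg _
    nlinarith [sq_nonneg (r k - 1)]
  have hrbar0 : 0 ≤ rbar := add_nonneg zero_le_one (tsum_nonneg fun _ => sq_nonneg _)
  set s : ℕ → ℝ := fun k => 6 * ε k + 2 * a (k * h) ^ 2 * (h * κ + ‖Nop‖ + rbar) ^ 2 with hs
  have hss : Summable s := (hεs.mul_left 6).add ((hαs2.mul_left 2).mul_right _)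
  have hs0 : ∀ k, 0 ≤ s k := fun k => by have := hε0 k; positivity
  have hαlim : Tendsto (fun k => a (k * h)) atTop (nhds 0) :=
    ha0.comp (tendsto_id.atTop_mul_const' hh)
  obtain ⟨m1, hm1⟩ : ∃ m1, ∀ m ≥ m1,
      ‖a (m * h) • (Nop + (h : ℝ) • L)‖ ≤ 1 ∧ ε m ≤ 1 ∧ k0 ≤ m * h := by
    have h1 : Tendsto (fun m => ‖a (m * h) • (Nop + (h : ℝ) • L)‖) atTop (nhds 0) := by
      simpa using (hαlim.smul_const (Nop + (h : ℝ) • L)).norm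
    refine eventually_atTop.1 ((h1.eventually (ge_mem_nhds one_pos)).and
      ((hεs.tendsto_atTop_zero.eventually (ge_mem_nhds one_pos)).and ?_))
    exact (tendsto_id.atTop_mul_const' hh).eventually_ge_atTop k0
  have hmain : ∀ m ≥ m1, ∀ δ > 0, ∃ k, ∫ ω, ‖e (m * h + k * h) ω‖ ^ 2 ∂P
      ≤ 2 * (c * ∑' l, a (l + m * h) ^ 2)
        + 4 * ((∑' k, s (k + m)) * ∫ ω, ‖e (m * h) ω‖ ^ 2 ∂P) + δ := by
    intro m hm δ hδ
    have idx : ∀ k l, m * h + (k * h + l) = (k + m) * h + l := fun k l => by ring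
    have idx0 : ∀ k, m * h + k * h = (k + m) * h := fun k => by ring
    have has' : ¬ Summable fun k => a ((k + m) * h) := fun hcon =>
      not_summable_block ha hanti has hh ((summable_nat_add_iff (f := fun k => a (k * h)) m).1 hcon)
    have := exists_integral_norm_sq_le (P := P) (F := fun l => F (m * h + l))
      (G := fun l => G (m * h + l))
      (fun i j hij => hF (Nat.add_le_add_left hij _)) (fun l => hFG _) (fun l => G.le _)
      (T := fun l => T (m * h + l)) (L := L) (fun l => hTF (m * h + l)) (fun l => hTG (m * h + l))
      (fun l => hT (m * h + l)) hL (fun l => hTκ (m * h + l)) le_rfl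
      (a := fun l => a (m * h + l)) (b := fun l => b (m * h + l)) (fun l => ha _) (fun l => hb _)
      (fun l => hk0 _ ((hm1 m hm).2.2.trans (Nat.le_add_right _ _)))
      (by simpa only [add_comm (m * h)] using
        (summable_nat_add_iff (f := fun i => a i ^ 2) (m * h)).2 ha2)
      (n := fun l => n (m * h + l)) (e := fun l => e (m * h + l)) (c := c)
      (fun l => hnm (m * h + l)) (fun l => hn2 _) (fun l => hn _) (fun l => hnc _)
      (hem (m * h)) (heL (m * h)) (fun l => hrec (m * h + l))
      (h := h) (Nop := Nop) (α := fun k => a ((k + m) * h)) (fun k => ha _) hQ hQ0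
      (fun k => (hm1 (k + m) (by lia)).1) has' (ρ := fun k => ρ (k + m))
      (fun k l hl => by
        rw [idx]
        refine (abs_sub_block_start_le hanti hC hC0 (k + m) hl).trans ?_
        have := mul_nonneg hC0 (hq0 (k + m))
        simp only [hρ, hq] at this ⊢
        linarith)
      (fun k l hl => by rw [idx]; exact abs_sub_block_start_le' hanti hC hC0 (k + m) hl)
      (R := fun k => R (k + m)) (fun k => hRm _) (r := fun k => r (k + m)) (rbar := rbar)
      (fun k => hR _) (fun k => hrle _) hrbar0
      (fun k p p' hp hp' hp2 hp2' => by
        simp only [idx]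
        exact hR0 (k + m) p p' (hp.mono (hF (idx0 k).le)) (hp'.mono (hF (idx0 k).le)) hp2 hp2')
      (ε := fun k => ε (k + m)) (fun k => (hm1 (k + m) (by lia)).2.1) (fun k => hε0 _)
      (fun k => by simp only [idx]; exact hε (k + m))
      ((summable_nat_add_iff (f := s) m).2 hss) hδ
    simpa only [add_comm (m * h) _, zero_add] using this
  have hlim : Tendsto (fun l => ∫ ω, ‖e l ω‖ ^ 2 ∂P) atTop (nhds 0) := by
    set Vmax : ℝ := ∫ ω, ‖e k0 ω‖ ^ 2 ∂P + c * ∑' i, a (i + k0) ^ 2 with hVmax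
    have hta := _root_.tendsto_sum_nat_add fun i => a i ^ 2
    have hts := _root_.tendsto_sum_nat_add s
    have hlm : Tendsto (fun m => m * h) atTop atTop := tendsto_id.atTop_mul_const' hh
    have hφ : Tendsto (fun m => 2 * (c * ∑' l, a (l + m * h) ^ 2)
        + 4 * ((∑' k, s (k + m)) * Vmax)) atTop (nhds 0) := by
      simpa using (((hta.comp hlm).const_mul c).const_mul 2).add
        ((hts.mul_const Vmax).const_mul 4)
    have hψ : Tendsto (fun l => c * ∑' i, a (i + l) ^ 2) atTop (nhds 0) := by
      simpa using hta.const_mul c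
    refine tendsto_order.2 ⟨fun η hη => .of_forall fun l =>
      hη.trans_le (integral_nonneg fun ω => by positivity), fun η hη => ?_⟩
    obtain ⟨l1, hl1⟩ := eventually_atTop.1
      (hψ.eventually (gt_mem_nhds (show (0 : ℝ) < η / 4 by positivity)))
    obtain ⟨m, hmφ, hm, hml⟩ := ((hφ.eventually (gt_mem_nhds
      (show (0 : ℝ) < η / 4 by positivity))).and
        ((eventually_ge_atTop m1).and (hlm.eventually_ge_atTop l1))).exists
    obtain ⟨k, hk⟩ := hmain m hm (η / 4) (by positivity)
    refine eventually_atTop.2 ⟨m * h + k * h, fun l hl => ?_⟩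
    obtain ⟨j, rfl⟩ := Nat.exists_eq_add_of_le hl
    have hmk := (hm1 m hm).2.2
    have h1 := hV (m * h + k * h) (by lia) j
    have h2 := hl1 (m * h + k * h) (by lia)
    have h3 : ∫ ω, ‖e (m * h) ω‖ ^ 2 ∂P ≤ Vmax := by
      have := hV k0 le_rfl (m * h - k0)
      rwa [Nat.add_sub_cancel' hmk] at this
    have h4 : (∑' k, s (k + m)) * ∫ ω, ‖e (m * h) ω‖ ^ 2 ∂P ≤ (∑' k, s (k + m)) * Vmax :=
      mul_le_mul_of_nonneg_left h3 (tsum_nonneg fun _ => hs0 _)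
    linarith
  refine ⟨heL, hlim, ?_⟩
  have hsh : Tendsto (fun l => l + k0) atTop atTop := tendsto_add_atTop_nat k0
  have hae := ae_tendsto_zero_of_contraction_add_noise (P := P)
    (G := ⟨fun l => G (l + k0), fun i j hij => G.mono (Nat.add_le_add_right hij k0),
      fun l => G.le _⟩) (e := fun l => e (l + k0)) (n := fun l => n (l + k0))
    (D := fun l => D (l + k0)) (a := fun l => a (l + k0)) (c := c)
    (fun l => heG _) (fun l => heL _) (fun l => hDG _) (fun l => hD _)
    (fun l ω => (hDle _ ω).trans (hk0 _ (by lia)))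
    (fun l => by
      have := (hnm (l + k0)).mono (hFG _)
      rwa [Nat.add_right_comm] at this)
    (fun l => hn2 _) (fun l => hn _) (fun l => hnc _)
    ((summable_nat_add_iff (f := fun i => a i ^ 2) k0).2 ha2)
    (fun l ω => by
      have := hrec (l + k0) ω
      rwa [Nat.add_right_comm] at this) (hlim.comp hsh)
  filter_upwards [hae] with ω hω
  exact (tendsto_add_atTop_iff_nat (f := fun l => ‖e l ω‖) k0).1 hω

end Consistency
section NetworkOperators

variable {H : Type*} [NormedAddCommGroup H] [InnerProductSpace ℝ H] {N : ℕ}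

/-- The `i`-th coordinate inclusion into the Hilbert sum of `N` copies of `H`. -/
def networkIncl (i : Fin N) : H →L[ℝ] PiLp 2 fun _ : Fin N => H :=
  ((PiLp.continuousLinearEquiv 2 ℝ fun _ : Fin N => H).symm :
    (Fin N → H) →L[ℝ] PiLp 2 fun _ : Fin N => H) ∘L
    ContinuousLinearMap.single ℝ (fun _ : Fin N => H) i

@[simp]
lemma networkIncl_apply (i j : Fin N) (x : H) : networkIncl i x j = if j = i then x else 0 := by
  simp [networkIncl]

/-- The diagonal operator on the Hilbert sum of `N` copies of `H`. -/
def diagOp (X : Fin N → H →L[ℝ] H) :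
    (PiLp 2 fun _ : Fin N => H) →L[ℝ] PiLp 2 fun _ : Fin N => H :=
  ∑ i, networkIncl i ∘L X i ∘L PiLp.proj 2 (fun _ : Fin N => H) i

@[simp]
lemma diagOp_apply (X : Fin N → H →L[ℝ] H) (x : PiLp 2 fun _ : Fin N => H) (i : Fin N) :
    diagOp X x i = X i (x i) := by
  simp [diagOp, sum_apply]

lemma diagOp_sub (X Y : Fin N → H →L[ℝ] H) :
    diagOp X - diagOp Y = diagOp fun i => X i - Y i := by
  ext x i
  simp [sub_apply]

lemma norm_diagOp_le {X : Fin N → H →L[ℝ] H} {c : ℝ} (hc : 0 ≤ c) (hX : ∀ i, ‖X i‖ ≤ c) :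
    ‖diagOp X‖ ≤ c := by
  refine ContinuousLinearMap.opNorm_le_bound _ hc fun x => ?_
  refine le_of_sq_le_sq ?_ (by positivity)
  rw [mul_pow, PiLp.norm_sq_eq_of_L2, PiLp.norm_sq_eq_of_L2, Finset.mul_sum]
  refine Finset.sum_le_sum fun i _ => ?_
  rw [← mul_pow, diagOp_apply]
  have := (X i).le_of_opNorm_le (hX i) (x i)
  gcongr

lemma isPositive_diagOp {X : Fin N → H →L[ℝ] H} (hX : ∀ i, (X i).IsPositive) :
    (diagOp X).IsPositive := by
  refine ⟨fun x y => ?_, fun x => ?_⟩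
  · simp only [ContinuousLinearMap.coe_coe, PiLp.inner_apply, diagOp_apply]
    exact Finset.sum_congr rfl fun i _ => (hX i).isSymmetric _ _
  · simp only [ContinuousLinearMap.reApplyInnerSelf_apply, PiLp.inner_apply, diagOp_apply,
      RCLike.re_to_real]
    exact Finset.sum_nonneg fun i _ => (hX i).inner_nonneg_left _

/-- The Laplacian of a weighted graph, acting on `H`-valued functions on the nodes. -/
def networkLaplacian (A : Fin N → Fin N → ℝ) :
    (PiLp 2 fun _ : Fin N => H) →L[ℝ] PiLp 2 fun _ : Fin N => H :=
  ∑ i, networkIncl i ∘L ∑ j, A i j •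
    (PiLp.proj (𝕜 := ℝ) 2 (fun _ : Fin N => H) i - PiLp.proj (𝕜 := ℝ) 2 (fun _ : Fin N => H) j)

@[simp]
lemma networkLaplacian_apply (A : Fin N → Fin N → ℝ) (x : PiLp 2 fun _ : Fin N => H)
    (i : Fin N) : networkLaplacian A x i = ∑ j, A i j • (x i - x j) := by
  simp only [networkLaplacian, sum_apply, ContinuousLinearMap.comp_apply, WithLp.ofLp_sum,
    Finset.sum_apply, networkIncl_apply, Finset.sum_ite_eq, Finset.mem_univ, if_true, smul_apply, sub_apply,
    PiLp.proj_apply]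

lemma inner_networkLaplacian {A : Fin N → Fin N → ℝ} (hA : ∀ i j, A i j = A j i)
    (x y : PiLp 2 fun _ : Fin N => H) :
    ⟪networkLaplacian A x, y⟫ = (∑ i, ∑ j, A i j * ⟪x i - x j, y i - y j⟫) / 2 := by
  have h1 : ⟪networkLaplacian A x, y⟫ = ∑ i, ∑ j, A i j * ⟪x i - x j, y i⟫ := by
    simp [PiLp.inner_apply, sum_inner, real_inner_smul_left]
  have h2 : ∑ i, ∑ j, A i j * ⟪x i - x j, y i⟫ = ∑ i, ∑ j, A i j * ⟪x j - x i, y j⟫ := by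
    rw [Finset.sum_comm]
    exact Finset.sum_congr rfl fun i _ => Finset.sum_congr rfl fun j _ => by rw [hA j i]
  have h3 : ∑ i, ∑ j, A i j * ⟪x i - x j, y i - y j⟫
      = ∑ i, ∑ j, A i j * ⟪x i - x j, y i⟫ + ∑ i, ∑ j, A i j * ⟪x j - x i, y j⟫ := by
    simp only [← Finset.sum_add_distrib]
    refine Finset.sum_congr rfl fun i _ => Finset.sum_congr rfl fun j _ => ?_
    simp only [inner_sub_left, inner_sub_right]
    ring
  rw [h1, h3, ← h2]
  ring

lemma isPositive_networkLaplacian {A : Fin N → Fin N → ℝ} (hA : ∀ i j, A i j = A j i)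
    (hA0 : ∀ i j, 0 ≤ A i j) : (networkLaplacian (H := H) A).IsPositive := by
  refine ⟨fun x y => ?_, fun x => ?_⟩
  · simp only [ContinuousLinearMap.coe_coe]
    rw [inner_networkLaplacian hA, real_inner_comm, inner_networkLaplacian hA]
    simp only [real_inner_comm]
  · rw [ContinuousLinearMap.reApplyInnerSelf_apply, inner_networkLaplacian hA]
    exact div_nonneg (Finset.sum_nonneg fun i _ => Finset.sum_nonneg fun j _ =>
      mul_nonneg (hA0 i j) real_inner_self_nonneg) zero_le_two

/-- On a connected graph, the kernel of the Laplacian consists of the consensus vectors. -/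
lemma consensus_of_inner_networkLaplacian_eq_zero {A : Fin N → Fin N → ℝ}
    (hA : ∀ i j, A i j = A j i) (hA0 : ∀ i j, 0 ≤ A i j)
    (hconn : ∀ i j : Fin N, Relation.ReflTransGen (fun p q : Fin N => 0 < A p q) i j)
    {x : PiLp 2 fun _ : Fin N => H} (hx : ⟪networkLaplacian A x, x⟫ = 0) (i j : Fin N) :
    x i = x j := by
  rw [inner_networkLaplacian hA, _root_.div_eq_zero_iff, or_iff_left two_ne_zero] at hx
  have hnn : ∀ p q, 0 ≤ A p q * ⟪x p - x q, x p - x q⟫ :=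
    fun p q => mul_nonneg (hA0 p q) real_inner_self_nonneg
  have hz : ∀ p q, A p q * ⟪x p - x q, x p - x q⟫ = 0 := fun p q => by
    have h1 := (Finset.sum_eq_zero_iff_of_nonneg
      (fun p _ => Finset.sum_nonneg fun q _ => hnn p q)).1 hx p (Finset.mem_univ p)
    exact (Finset.sum_eq_zero_iff_of_nonneg (fun q _ => hnn p q)).1 h1 q (Finset.mem_univ q)
  induction hconn i j with
  | refl => rfl
  | tail _ hpq ih =>
    rw [ih]
    exact sub_eq_zero.1 (inner_self_eq_zero.1 ((mul_eq_zero.1 (hz _ _)).resolve_left hpq.ne'))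

lemma inner_diagOp_add_networkLaplacian_pos {A : Fin N → Fin N → ℝ}
    (hA : ∀ i j, A i j = A j i) (hA0 : ∀ i j, 0 ≤ A i j)
    (hconn : ∀ i j : Fin N, Relation.ReflTransGen (fun p q : Fin N => 0 < A p q) i j)
    {X : Fin N → H →L[ℝ] H} (hX : ∀ i, (X i).IsPositive)
    (hX0 : ∀ g : H, g ≠ 0 → 0 < ⟪(∑ i, X i) g, g⟫) {c : ℝ} (hc : 0 < c)
    {x : PiLp 2 fun _ : Fin N => H} (hx : x ≠ 0) :
    0 < ⟪(diagOp X + c • networkLaplacian (H := H) A) x, x⟫ := by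
  have h1 := (isPositive_diagOp hX).inner_nonneg_left x
  have h2 := (isPositive_networkLaplacian (H := H) hA hA0).inner_nonneg_left x
  rw [add_apply, smul_apply, inner_add_left, real_inner_smul_left]
  by_contra hcon
  have h3 := mul_nonneg hc.le h2
  have hL : ⟪networkLaplacian A x, x⟫ = 0 :=
    (mul_eq_zero.1 (by linarith : c * ⟪networkLaplacian A x, x⟫ = 0)).resolve_left hc.ne'
  have hcons := consensus_of_inner_networkLaplacian_eq_zero hA hA0 hconn hL
  obtain ⟨i0, hi0⟩ : ∃ i, x i ≠ 0 := by
    by_contra! hall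
    exact hx (PiLp.ext hall)
  have h4 := hX0 _ hi0
  rw [sum_apply, sum_inner] at h4
  have h5 : ⟪diagOp X x, x⟫ = ∑ i, ⟪X i (x i0), x i0⟫ := by
    rw [PiLp.inner_apply]
    exact Finset.sum_congr rfl fun i _ => by rw [diagOp_apply, hcons i i0]
  linarith

end NetworkOperators
section Measurability

variable {Ω H : Type*} [NormedAddCommGroup H] [InnerProductSpace ℝ H]

/-- Pettis' measurability criterion in Hilbert spaces. -/
lemma stronglyMeasurable_of_measurable_inner [CompleteSpace H] {m : MeasurableSpace Ω} {φ : Ω → H}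
    (hsep : TopologicalSpace.IsSeparable (Set.range φ))
    (hφ : ∀ g, Measurable fun ω => ⟪g, φ ω⟫) : StronglyMeasurable φ := by
  obtain ⟨c, hc, hcφ⟩ := hsep
  obtain ⟨d, hd⟩ := (hc.insert 0).exists_eq_range (Set.insert_nonempty _ _)
  let U : ℕ → Submodule ℝ H := fun n => Submodule.span ℝ (d '' Set.Iio n)
  have hfd : ∀ n, FiniteDimensional ℝ (U n) := fun n =>
    FiniteDimensional.span_of_finite ℝ ((Set.finite_Iio n).image d)
  have hU : Monotone U := fun i j hij =>
    Submodule.span_mono (Set.image_mono (Set.Iio_subset_Iio hij))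
  refine stronglyMeasurable_of_tendsto atTop (f := fun n ω => (U n).starProjection (φ ω))
    (fun n => ?_) (tendsto_pi_nhds.2 fun ω => ?_)
  · rw [(stdOrthonormalBasis ℝ (U n)).starProjection_eq_sum_rankOne]
    simp only [sum_apply, InnerProductSpace.rankOne_apply]
    exact Finset.stronglyMeasurable_fun_sum _ fun i _ =>
      (hφ _).stronglyMeasurable.smul_const _
  · convert! Submodule.starProjection_tendsto_closure_iSup U hU (φ ω)
    rw [eq_comm, Submodule.starProjection_eq_self_iff]
    refine closure_mono (fun x hx => ?_) (hcφ ⟨ω, rfl⟩)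
    obtain ⟨n, rfl⟩ : x ∈ Set.range d := hd ▸ Set.mem_insert_of_mem 0 hx
    exact (le_iSup U (n + 1)) (Submodule.subset_span ⟨n, Nat.lt_succ_self n, rfl⟩)

lemma continuous_rankOne_self : Continuous fun x : H => rankOne x x :=
  ((InnerProductSpace.rankOne ℝ (E := H) (F := H)).continuous.clm_apply continuous_id)

lemma isPositive_rankOne_self (x : H) : (rankOne x x).IsPositive :=
  InnerProductSpace.isPositive_rankOne_self x

lemma norm_rankOne_self (x : H) : ‖rankOne x x‖ = ‖x‖ ^ 2 := by
  rw [sq]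
  exact InnerProductSpace.norm_rankOne x x

lemma continuous_of_continuousOn_kernel {X : Type*} [TopologicalSpace X] {S : Set X}
    {K : X → X → ℝ} (hK : ContinuousOn (fun p : X × X => K p.1 p.2) (S ×ˢ S)) {Kx : S → H}
    (hKer : ∀ x y : S, ⟪Kx x, Kx y⟫ = K x y) : Continuous Kx := by
  have hcont : Continuous fun p : S × S => K p.1 p.2 :=
    hK.comp_continuous (f := fun p : S × S => ((p.1 : X), (p.2 : X))) (by fun_prop)
      fun p => ⟨p.1.2, p.2.2⟩
  refine continuous_iff_continuousAt.2 fun x => tendsto_iff_norm_sub_tendsto_zero.2 ?_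
  have h1 : ∀ y : S, ‖Kx y - Kx x‖ = √(K y y - 2 * K y x + K x x) := fun y => by
    rw [← hKer, ← hKer, ← hKer, real_inner_self_eq_norm_sq, real_inner_self_eq_norm_sq,
      ← norm_sub_sq_real, Real.sqrt_sq (norm_nonneg _)]
  simp_rw [h1]
  have h2 : Continuous fun y : S => √(K y y - 2 * K y x + K x x) := by
    have c1 : Continuous fun y : S => K y y := hcont.comp (continuous_id.prodMk continuous_id)
    have c2 : Continuous fun y : S => K y x := hcont.comp (continuous_id.prodMk continuous_const)
    exact ((c1.sub (continuous_const.mul c2)).add continuous_const).sqrt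
  have h3 := h2.tendsto x
  rwa [show K x x - 2 * K x x + K x x = 0 by ring, Real.sqrt_zero] at h3

end Measurability

lemma condExp_clm_apply {Ω E : Type*} {m m0 : MeasurableSpace Ω} {P : Measure Ω}
    [NormedAddCommGroup E] [NormedSpace ℝ E] [CompleteSpace E]
    {F : Ω → E →L[ℝ] ℝ} (hF : StronglyMeasurable[m] F) {Y : Ω → E}
    (hFY : Integrable (fun ω => F ω (Y ω)) P) (hY : Integrable Y P) :
    P[fun ω => F ω (Y ω) | m] =ᵐ[P] fun ω => F ω ((P[Y | m]) ω) := by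
  have key := condExp_bilin_of_stronglyMeasurable_left (m := m) (μ := P)
    (ContinuousLinearMap.id ℝ (E →L[ℝ] ℝ)) (f := F) (g := Y) hF hFY hY
  exact key

section Noise

variable {Ω H : Type*} [NormedAddCommGroup H] [InnerProductSpace ℝ H] {m0 : MeasurableSpace Ω}
  {P : Measure Ω} [IsProbabilityMeasure P]

/-- Enlarging the conditioning σ-algebra `mB` by a σ-algebra `mX` independent of `mB` and `v`
jointly preserves a zero conditional mean. -/
lemma condExp_sup_eq_zero_of_indep {mX mB mV : MeasurableSpace Ω} (hX : mX ≤ m0) (hV : mV ≤ m0)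
    (hB : mB ≤ mV) (hind : Indep mX mV P) {v : Ω → ℝ} (hv : StronglyMeasurable[mV] v)
    (hvi : Integrable v P) (h0 : P[v | mB] =ᵐ[P] 0) : P[v | mX ⊔ mB] =ᵐ[P] 0 := by
  have hsup : mX ⊔ mB ≤ m0 := sup_le hX (hB.trans hV)
  have hB0 : ∀ s, MeasurableSet[mB] s → ∫ ω in s, v ω ∂P = 0 := fun s hs => by
    rw [← setIntegral_condExp (hB.trans hV) hvi hs,
      integral_congr_ae (ae_restrict_of_ae h0)]
    simp
  have hgen : mX ⊔ mB = MeasurableSpace.generateFrom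
      (Set.image2 (· ∩ ·) {A | MeasurableSet[mX] A} {B | MeasurableSet[mB] B}) := by
    refine le_antisymm (sup_le (fun A hA => ?_) fun B hB' => ?_)
      (MeasurableSpace.generateFrom_le ?_)
    · exact MeasurableSpace.measurableSet_generateFrom
        ⟨A, hA, Set.univ, MeasurableSet.univ, Set.inter_univ A⟩
    · exact MeasurableSpace.measurableSet_generateFrom
        ⟨Set.univ, MeasurableSet.univ, B, hB', Set.univ_inter B⟩
    · rintro _ ⟨A, hA, B, hB', rfl⟩
      exact @MeasurableSet.inter _ (mX ⊔ mB) _ _ ((le_sup_left : mX ≤ mX ⊔ mB) A hA)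
        ((le_sup_right : mB ≤ mX ⊔ mB) B hB')
  have hpi : IsPiSystem
      (Set.image2 (· ∩ ·) {A | MeasurableSet[mX] A} {B | MeasurableSet[mB] B}) := by
    rintro _ ⟨A, hA, B, hB', rfl⟩ _ ⟨A', hA', B', hB'', rfl⟩ -
    exact ⟨A ∩ A', @MeasurableSet.inter _ mX _ _ hA hA', B ∩ B',
      @MeasurableSet.inter _ mB _ _ hB' hB'', Set.inter_inter_inter_comm _ _ _ _⟩
  have key : ∀ s, MeasurableSet[mX ⊔ mB] s → ∫ ω in s, v ω ∂P = 0 := by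
    refine MeasurableSpace.induction_on_inter hgen hpi (by simp) ?_ ?_ ?_
    · rintro _ ⟨A, hA, B, hB', rfl⟩
      have h1 := condExp_indep_eq hV hX (hv.indicator (hB B hB')) hind.symm
      dsimp only
      rw [← setIntegral_indicator (hV B (hB B hB')),
        ← setIntegral_condExp hX (hvi.indicator (hV B (hB B hB'))) hA,
        integral_congr_ae (ae_restrict_of_ae h1)]
      simp [integral_indicator (hV B (hB B hB')), hB0 B hB']
    · intro t ht h1
      have h2 := integral_add_compl (hsup t ht) hvi
      have h3 := hB0 Set.univ MeasurableSet.univ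
      rw [setIntegral_univ] at h3
      linarith
    · intro f hd hf h1
      rw [integral_iUnion (fun i => hsup _ (hf i)) hd hvi.integrableOn]
      simp [h1]
  symm
  refine ae_eq_condExp_of_forall_setIntegral_eq hsup hvi (fun s _ _ => integrableOn_zero)
    (fun s hs _ => ?_) stronglyMeasurable_zero.aestronglyMeasurable
  simp [key s hs]

lemma meanOrthogonal_toLp_smul {m : MeasurableSpace Ω} (hm : m ≤ m0) {N : ℕ}
    {v : Fin N → Ω → ℝ} (hv : ∀ i, P[v i | m] =ᵐ[P] 0) (hv2 : ∀ i, MemLp (v i) 2 P)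
    {φ : Fin N → Ω → H} (hφ : ∀ i, StronglyMeasurable[m] (φ i)) {c : ℝ}
    (hφc : ∀ i ω, ‖φ i ω‖ ≤ c) :
    MeanOrthogonal m P fun ω =>
      (WithLp.toLp 2 fun i => v i ω • φ i ω : PiLp 2 fun _ : Fin N => H) := by
  intro p hp hp2
  have hpi : ∀ i, StronglyMeasurable[m] fun ω => p ω i := fun i =>
    (PiLp.continuous_apply 2 _ i).comp_stronglyMeasurable hp
  have hX : ∀ i, StronglyMeasurable[m] fun ω => ⟪p ω i, φ i ω⟫ := fun i => (hpi i).inner (hφ i)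
  have hX2 : ∀ i, MemLp (fun ω => ⟪p ω i, φ i ω⟫) 2 P := fun i =>
    hp2.of_le_mul (c := c) ((hX i).mono hm).aestronglyMeasurable <| ae_of_all _ fun ω => by
      have h1 := norm_inner_le_norm (𝕜 := ℝ) (p ω i) (φ i ω)
      have h2 := PiLp.norm_apply_le (p ω) i
      calc ‖⟪p ω i, φ i ω⟫‖ ≤ ‖p ω i‖ * ‖φ i ω‖ := h1
        _ ≤ ‖p ω‖ * c := mul_le_mul h2 (hφc i ω) (norm_nonneg _) (norm_nonneg _)
        _ = c * ‖p ω‖ := mul_comm _ _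
  have hint : ∀ i, Integrable ((fun ω => ⟪p ω i, φ i ω⟫) * v i) P := fun i =>
    (hX2 i).integrable_mul (hv2 i)
  have hz : ∀ i, ∫ ω, ((fun ω => ⟪p ω i, φ i ω⟫) * v i) ω ∂P = 0 := fun i => by
    rw [← integral_condExp hm]
    refine integral_eq_zero_of_ae ?_
    filter_upwards [condExp_mul_of_stronglyMeasurable_left (hX i) (hint i)
      ((hv2 i).integrable one_le_two), hv i] with ω h1 h2
    simp [h1, h2]
  have e1 : ∀ ω, ⟪p ω, (WithLp.toLp 2 fun i => v i ω • φ i ω : PiLp 2 fun _ : Fin N => H)⟫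
      = ∑ i, ((fun ω => ⟪p ω i, φ i ω⟫) * v i) ω := fun ω => by
    rw [PiLp.inner_apply]
    refine Finset.sum_congr rfl fun i _ => ?_
    simp only [real_inner_smul_right, Pi.mul_apply]
    ring
  simp_rw [e1]
  rw [integral_finsetSum _ fun i _ => hint i]
  exact Finset.sum_eq_zero fun i _ => hz i

lemma integral_inner_condExp_apply [CompleteSpace H] {m : MeasurableSpace Ω} (hm : m ≤ m0)
    {Y : Ω → H →L[ℝ] H} (hY : Integrable Y P) {κ : ℝ} (hYκ : ∀ ω, ‖Y ω‖ ≤ κ) {p q : Ω → H}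
    (hp : StronglyMeasurable[m] p) (hq : StronglyMeasurable[m] q) (hp2 : MemLp p 2 P)
    (hq2 : MemLp q 2 P) :
    Integrable (fun ω => ⟪p ω, Y ω (q ω) - (P[Y | m]) ω (q ω)⟫) P ∧
      ∫ ω, ⟪p ω, Y ω (q ω) - (P[Y | m]) ω (q ω)⟫ ∂P = 0 := by
  have hc : Continuous fun z : H × H =>
      (innerSL ℝ z.1) ∘L (ContinuousLinearMap.apply ℝ H z.2 : (H →L[ℝ] H) →L[ℝ] H) :=
    ((innerSL ℝ).continuous.comp continuous_fst).clm_comp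
      ((ContinuousLinearMap.apply ℝ H).continuous.comp continuous_snd)
  have hYqm : AEStronglyMeasurable[m0] (fun ω => Y ω (q ω)) P :=
    (continuous_fst.clm_apply continuous_snd :
      Continuous fun z : (H →L[ℝ] H) × H => z.1 z.2).comp_aestronglyMeasurable (hY.1.prodMk hq2.1)
  have hYq : MemLp (fun ω => Y ω (q ω)) 2 P :=
    hq2.of_le_mul (c := κ) hYqm (ae_of_all _ fun ω => (Y ω).le_of_opNorm_le (hYκ ω) _)
  have hint := hp2.integrable_inner_of_two hYq
  let F : Ω → (H →L[ℝ] H) →L[ℝ] ℝ := fun ω =>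
    (innerSL ℝ (p ω)) ∘L (ContinuousLinearMap.apply ℝ H (q ω) : (H →L[ℝ] H) →L[ℝ] H)
  have hF : StronglyMeasurable[m] F := hc.comp_stronglyMeasurable (hp.prodMk hq)
  have hFint : Integrable (fun ω => F ω (Y ω)) P := hint
  have key := condExp_clm_apply hF hFint hY
  have hcond : (P[fun ω => ⟪p ω, Y ω (q ω)⟫ | m]) =ᵐ[P]
      fun ω => ⟪p ω, (P[Y | m]) ω (q ω)⟫ := by
    exact key
  have hint2 : Integrable (fun ω => ⟪p ω, (P[Y | m]) ω (q ω)⟫) P :=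
    integrable_condExp.congr hcond
  have e1 : (fun ω => ⟪p ω, Y ω (q ω) - (P[Y | m]) ω (q ω)⟫)
      = (fun ω => ⟪p ω, Y ω (q ω)⟫) - fun ω => ⟪p ω, (P[Y | m]) ω (q ω)⟫ :=
    funext fun ω => inner_sub_right _ _ _
  rw [e1]
  refine ⟨hint.sub hint2, ?_⟩
  rw [integral_sub' hint hint2, ← integral_congr_ae hcond, integral_condExp hm, sub_self]

end Noise

section NetworkMeasurability

variable {Ω H : Type*} [NormedAddCommGroup H] [InnerProductSpace ℝ H] {N : ℕ}

lemma toLp_eq_sum_networkIncl (x : Fin N → H) :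
    (WithLp.toLp 2 x : PiLp 2 fun _ : Fin N => H) = ∑ i, networkIncl i (x i) := by
  ext j
  simp

lemma stronglyMeasurable_toLp {m : MeasurableSpace Ω} {x : Fin N → Ω → H}
    (hx : ∀ i, StronglyMeasurable (x i)) :
    StronglyMeasurable fun ω => (WithLp.toLp 2 fun i => x i ω : PiLp 2 fun _ : Fin N => H) := by
  simp_rw [toLp_eq_sum_networkIncl]
  exact Finset.stronglyMeasurable_fun_sum _ fun i _ =>
    (networkIncl i).continuous.comp_stronglyMeasurable (hx i)

lemma memLp_toLp {m : MeasurableSpace Ω} {P : Measure Ω} {p : ℝ≥0∞} {x : Fin N → Ω → H}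
    (hx : ∀ i, MemLp (x i) p P) :
    MemLp (fun ω => (WithLp.toLp 2 fun i => x i ω : PiLp 2 fun _ : Fin N => H)) p P := by
  simp_rw [toLp_eq_sum_networkIncl]
  exact memLp_finsetSum _ fun i _ => (networkIncl (H := H) i).comp_memLp' (hx i)

lemma stronglyMeasurable_diagOp {m : MeasurableSpace Ω} {X : Fin N → Ω → H →L[ℝ] H}
    (hX : ∀ i, StronglyMeasurable (X i)) : StronglyMeasurable fun ω => diagOp fun i => X i ω := by
  unfold diagOp
  exact Finset.stronglyMeasurable_fun_sum _ fun i _ =>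
    (continuous_const.clm_comp (continuous_id.clm_comp continuous_const) :
      Continuous fun Z : H →L[ℝ] H =>
        networkIncl i ∘L Z ∘L PiLp.proj 2 (fun _ : Fin N => H) i).comp_stronglyMeasurable (hX i)

lemma integral_norm_sq_toLp_smul_le {m m0 : MeasurableSpace Ω} {P : Measure Ω}
    [IsProbabilityMeasure P] (hm : m ≤ m0) {v : Fin N → Ω → ℝ}
    (hv2 : ∀ i, Integrable (fun ω => v i ω ^ 2) P) {β : ℝ}
    (hvβ : ∀ i, P[fun ω => v i ω ^ 2 | m] ≤ᵐ[P] fun _ => β) {φ : Fin N → Ω → H} {c : ℝ}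
    (hφc : ∀ i ω, ‖φ i ω‖ ≤ c) :
    ∫ ω, ‖(WithLp.toLp 2 fun i => v i ω • φ i ω : PiLp 2 fun _ : Fin N => H)‖ ^ 2 ∂P
      ≤ N * (c ^ 2 * β) := by
  have hvi : ∀ i, ∫ ω, v i ω ^ 2 ∂P ≤ β := fun i => by
    rw [← integral_condExp hm]
    simpa using integral_mono_ae integrable_condExp (integrable_const β) (hvβ i)
  calc ∫ ω, ‖(WithLp.toLp 2 fun i => v i ω • φ i ω : PiLp 2 fun _ : Fin N => H)‖ ^ 2 ∂P
      ≤ ∫ ω, ∑ i, c ^ 2 * v i ω ^ 2 ∂P := by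
        refine integral_mono_of_nonneg (ae_of_all _ fun ω => sq_nonneg _)
          (integrable_finsetSum _ fun i _ => (hv2 i).const_mul _) (ae_of_all _ fun ω => ?_)
        dsimp only
        rw [PiLp.norm_sq_eq_of_L2]
        refine Finset.sum_le_sum fun i _ => ?_
        rw [norm_smul, mul_pow, Real.norm_eq_abs, sq_abs, mul_comm]
        have := hφc i ω
        gcongr
    _ = ∑ i, c ^ 2 * ∫ ω, v i ω ^ 2 ∂P := by
        rw [integral_finsetSum _ fun i _ => (hv2 i).const_mul _]
        simp_rw [integral_const_mul]
    _ ≤ ∑ _i : Fin N, c ^ 2 * β := Finset.sum_le_sum fun i _ =>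
        mul_le_mul_of_nonneg_left (hvi i) (sq_nonneg _)
    _ = N * (c ^ 2 * β) := by simp

lemma integral_inner_diagOp_sub_condExp [CompleteSpace H] {m m0 : MeasurableSpace Ω}
    {P : Measure Ω} [IsProbabilityMeasure P] (hm : m ≤ m0) {Y : Fin N → ℕ → Ω → H →L[ℝ] H}
    (hY : ∀ i l, Integrable (Y i l) P) {κ : ℝ} (hYκ : ∀ i l ω, ‖Y i l ω‖ ≤ κ) (s : Finset ℕ)
    {p q : Ω → PiLp 2 fun _ : Fin N => H} (hp : StronglyMeasurable[m] p)
    (hq : StronglyMeasurable[m] q) (hp2 : MemLp p 2 P) (hq2 : MemLp q 2 P) :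
    ∫ ω, ⟪p ω, (∑ l ∈ s, diagOp (fun i => Y i l ω)
      - diagOp fun i => ∑ l ∈ s, (P[Y i l | m]) ω) (q ω)⟫ ∂P = 0 := by
  have hcoord : ∀ {x : Ω → PiLp 2 fun _ : Fin N => H}, StronglyMeasurable[m] x → MemLp x 2 P →
      ∀ i, StronglyMeasurable[m] (fun ω => x ω i) ∧ MemLp (fun ω => x ω i) 2 P :=
    fun hx hx2 i =>
      ⟨(PiLp.continuous_apply 2 _ i).comp_stronglyMeasurable hx,
        (PiLp.proj (𝕜 := ℝ) 2 (fun _ : Fin N => H) i).comp_memLp' hx2⟩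
  have key := fun i l => integral_inner_condExp_apply hm (hY i l) (hYκ i l)
    (hcoord hp hp2 i).1 (hcoord hq hq2 i).1 (hcoord hp hp2 i).2 (hcoord hq hq2 i).2
  have e1 : ∀ ω, ⟪p ω, (∑ l ∈ s, diagOp (fun i => Y i l ω)
      - diagOp fun i => ∑ l ∈ s, (P[Y i l | m]) ω) (q ω)⟫
      = ∑ i, ∑ l ∈ s, ⟪p ω i, Y i l ω (q ω i) - (P[Y i l | m]) ω (q ω i)⟫ := fun ω => by
    rw [PiLp.inner_apply]
    refine Finset.sum_congr rfl fun i _ => ?_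
    simp [sub_apply, sum_apply, ← inner_sum, Finset.sum_sub_distrib]
  simp_rw [e1]
  rw [integral_finsetSum _ fun i _ => integrable_finsetSum _ fun l _ => (key i l).1]
  refine Finset.sum_eq_zero fun i _ => ?_
  rw [integral_finsetSum _ fun l _ => (key i l).1]
  exact Finset.sum_eq_zero fun l _ => (key i l).2

end NetworkMeasurability

section Filtrations

variable {Ω : Type*} {N : ℕ}

/-- The σ-algebra generated by the noises before time `k`. -/
abbrev noiseHistory (v : Fin N → ℕ → Ω → ℝ) (k : ℕ) : MeasurableSpace Ω :=
  ⨆ s ∈ Finset.range k, ⨆ i : Fin N, MeasurableSpace.comap (v i s) (borel ℝ)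

lemma noiseHistory_mono (v : Fin N → ℕ → Ω → ℝ) : Monotone (noiseHistory v) := fun _ _ hkl =>
  biSup_mono fun _ hs => Finset.range_mono hkl hs

lemma noiseHistory_le_iSup (v : Fin N → ℕ → Ω → ℝ) (k : ℕ) :
    noiseHistory v k ≤ ⨆ (i : Fin N) (k : ℕ), MeasurableSpace.comap (v i k) (borel ℝ) :=
  iSup₂_le fun s _ => iSup_le fun i =>
    le_iSup₂ (f := fun (i : Fin N) (k : ℕ) => MeasurableSpace.comap (v i k) (borel ℝ)) i s

lemma measurable_noiseHistory (v : Fin N → ℕ → Ω → ℝ) {s k : ℕ} (hs : s < k) (i : Fin N) :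
    Measurable[noiseHistory v k] (v i s) := by
  rw [measurable_iff_comap_le, BorelSpace.measurable_eq (α := ℝ)]
  exact (le_iSup (fun i => MeasurableSpace.comap (v i s) (borel ℝ)) i).trans
    (le_iSup₂ (f := fun (s : ℕ) (_ : s ∈ Finset.range k) => ⨆ i : Fin N,
      MeasurableSpace.comap (v i s) (borel ℝ)) s (Finset.mem_range.2 hs))

variable {S H : Type*} [m0 : MeasurableSpace Ω] [NormedAddCommGroup H] [InnerProductSpace ℝ H]
  (Kx : S → H) (xi : Fin N → ℕ → Ω → S) (v : Fin N → ℕ → Ω → ℝ)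

lemma rkhsFilt_mono : Monotone (rkhsFilt Kx xi v) := fun _ _ hkl =>
  biSup_mono fun _ hs => Finset.range_mono hkl hs

lemma noiseHistory_le_rkhsFilt (k : ℕ) : noiseHistory v k ≤ rkhsFilt Kx xi v k :=
  iSup₂_mono fun _ _ => iSup_mono fun _ => le_sup_right

lemma measurable_inner_rkhsFilt {s k : ℕ} (hs : s < k) (i : Fin N) (g : H) :
    Measurable[rkhsFilt Kx xi v k] fun ω => ⟪g, Kx (xi i s ω)⟫ := by
  rw [measurable_iff_comap_le, BorelSpace.measurable_eq (α := ℝ)]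
  refine le_trans ?_ (le_iSup₂ (f := fun (s : ℕ) (_ : s ∈ Finset.range k) => ⨆ i : Fin N,
    ((⨆ g : H, MeasurableSpace.comap (fun ω => ⟪g, Kx (xi i s ω)⟫) (borel ℝ)) ⊔
      MeasurableSpace.comap (fun ω => v i s ω) (borel ℝ))) s (Finset.mem_range.2 hs))
  refine le_trans (le_sup_left.trans' ?_) (le_iSup (fun i : Fin N =>
    ((⨆ g : H, MeasurableSpace.comap (fun ω => ⟪g, Kx (xi i s ω)⟫) (borel ℝ)) ⊔
      MeasurableSpace.comap (fun ω => v i s ω) (borel ℝ))) i)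
  exact le_iSup (fun g : H => MeasurableSpace.comap (fun ω => ⟪g, Kx (xi i s ω)⟫) (borel ℝ)) g

lemma rkhsFilt_le_sup_noiseHistory {mX : MeasurableSpace Ω}
    (hX : ∀ i s, ∀ g : H, Measurable[mX] fun ω => ⟪g, Kx (xi i s ω)⟫) (k : ℕ) :
    @rkhsFilt Ω S H m0 _ _ N Kx xi v k ≤ mX ⊔ noiseHistory v k := by
  refine iSup₂_le fun s hs => iSup_le fun i => sup_le (iSup_le fun g => ?_) ?_
  · rw [← BorelSpace.measurable_eq (α := ℝ)]
    exact (measurable_iff_comap_le.1 (hX i s g)).trans le_sup_left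
  · rw [← BorelSpace.measurable_eq (α := ℝ)]
    exact (measurable_iff_comap_le.1
      (measurable_noiseHistory v (Finset.mem_range.1 hs) i)).trans le_sup_right

end Filtrations
section InputNoiseFiltration

variable {Ω X : Type*} [MeasurableSpace X] {S : Set X} {N : ℕ}

/-- The σ-algebra generated by all the inputs. -/
abbrev inputSigma (xi : Fin N → ℕ → Ω → S) : MeasurableSpace Ω :=
  ⨆ (i : Fin N) (k : ℕ), MeasurableSpace.comap (fun ω => (xi i k ω : X)) inferInstance

lemma measurable_inputSigma (xi : Fin N → ℕ → Ω → S) (i : Fin N) (k : ℕ) :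
    Measurable[inputSigma xi] (xi i k) := by
  have h1 : Measurable[inputSigma xi] fun ω => (xi i k ω : X) := by
    rw [measurable_iff_comap_le]
    exact le_iSup₂ (f := fun (i : Fin N) (k : ℕ) =>
      MeasurableSpace.comap (fun ω => (xi i k ω : X)) inferInstance) i k
  exact h1.subtype_mk

/-- The filtration generated by all the inputs and the past noises. -/
def inputNoiseFiltration {m0 : MeasurableSpace Ω} {xi : Fin N → ℕ → Ω → S}
    (hxi : ∀ i k, Measurable fun ω => (xi i k ω : X)) {v : Fin N → ℕ → Ω → ℝ}
    (hv : ∀ i k, Measurable (v i k)) : Filtration ℕ m0 where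
  seq k := inputSigma xi ⊔ noiseHistory v k
  mono' _ _ hkl := sup_le_sup_left (noiseHistory_mono v hkl) _
  le' k := by
    refine sup_le (iSup₂_le fun i k => (hxi i k).comap_le)
      ((noiseHistory_le_iSup v k).trans (iSup₂_le fun i k => ?_))
    rw [← BorelSpace.measurable_eq (α := ℝ)]
    exact (hv i k).comap_le

end InputNoiseFiltration

/-- Corollary 2. For the decentralized online learning algorithm in the RKHS
`H_K`, suppose `𝒢` is connected, Assumptions A3–A5 and Conditions C1–C3 hold. If there exist
positive self-adjoint operators `N₁,…,N_N ∈ L(H_K)` with `∑ᵢ Nᵢ > 0`, an integer `h > 0`,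
`μ₀ > 0` and a nonnegative summable sequence `τ(k)` with
`maxⱼ ‖Nⱼ − ∑ᵢ E[K_{xⱼ(i)} ⊗ K_{xⱼ(i)} | 𝓕(kh−1)]‖² ≤ μ₀ τ(k)` a.s., then the algorithm is mean
square and almost surely strongly consistent, and pointwisely almost surely strongly
consistent. -/
theorem decentralized_online_learning.stmt7
    {Ω : Type*} [MeasurableSpace Ω] (P : Measure Ω) [IsProbabilityMeasure P]
    -- the input space 𝒳 ⊆ ℝⁿ and the Mercer kernel K
    {n : ℕ} (S : Set (EuclideanSpace ℝ (Fin n))) (hS : S.Nonempty)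
    (K : EuclideanSpace ℝ (Fin n) → EuclideanSpace ℝ (Fin n) → ℝ)
    (hK_cont : ContinuousOn
      (fun p : EuclideanSpace ℝ (Fin n) × EuclideanSpace ℝ (Fin n) => K p.1 p.2) (S ×ˢ S))
    (hK_symm : ∀ x ∈ S, ∀ y ∈ S, K x y = K y x)
    -- the reproducing kernel Hilbert space H_K with kernel sections K_x, x ∈ 𝒳;
    -- the value of f ∈ H_K at x ∈ 𝒳 is f(x) = ⟪f, K_x⟫
    {HK : Type*} [NormedAddCommGroup HK] [InnerProductSpace ℝ HK] [CompleteSpace HK]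
    (Kx : S → HK)
    (hKer : ∀ x y : S, ⟪Kx x, Kx y⟫ = K x y)
    -- the weighted adjacency matrix of the graph 𝒢
    {N : ℕ} (hN : 0 < N)
    (A : Fin N → Fin N → ℝ)
    (hA_symm : ∀ i j, A i j = A j i) (hA_nonneg : ∀ i j, 0 ≤ A i j) (hA_diag : ∀ i, A i i = 0)
    -- the graph 𝒢 is connected
    (hconn : ∀ i j : Fin N, Relation.ReflTransGen (fun p q : Fin N => 0 < A p q) i j)
    -- random input data, noises and the unknown function f₀
    (xi : Fin N → ℕ → Ω → S)
    (hxi_meas : ∀ i k, Measurable (fun ω => (xi i k ω : EuclideanSpace ℝ (Fin n))))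
    (v : Fin N → ℕ → Ω → ℝ)
    (hv_meas : ∀ i k, Measurable (v i k))
    (f₀ : HK)
    -- gains
    (a b : ℕ → ℝ) (ha_pos : ∀ k, 0 < a k) (hb_pos : ∀ k, 0 < b k)
    -- Assumption A3: the inputs are independent of the noises
    (hA3 : Indep
        (⨆ (i : Fin N) (k : ℕ), MeasurableSpace.comap
          (fun ω => (xi i k ω : EuclideanSpace ℝ (Fin n))) inferInstance)
        (⨆ (i : Fin N) (k : ℕ), MeasurableSpace.comap (v i k) (borel ℝ)) P)
    -- Assumption A4: martingale difference noises with bounded conditional second moments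
    (hA4_int : ∀ i k, Integrable (v i k) P)
    (hA4_mds : ∀ i k, P[v i k | rkhsFilt Kx xi v k] =ᵐ[P] 0)
    (hA4_int2 : ∀ i k, Integrable (fun ω => (v i k ω) ^ 2) P)
    (β : ℝ) (hβ : 0 < β)
    (hA4_bdd : ∀ i k, P[fun ω => (v i k ω) ^ 2 | rkhsFilt Kx xi v k] ≤ᵐ[P] fun _ => β)
    -- Assumption A5: bounded kernel
    (hA5 : ∃ κ : ℝ, ∀ x : S, K x x ≤ κ)
    -- Conditions C1, C2, C3
    (hC1a : Antitone a) (hC1b : Antitone b)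
    (hC2a : Summable (fun k => a k ^ 2)) (hC2b : Summable (fun k => b k ^ 2))
    (hC3a : ¬ Summable a)
    (hC3b : ∃ C > (0 : ℝ), ∀ k, max (a k - a (k + 1)) |b k - a k| ≤ C * (a k ^ 2 + b k ^ 2))
    -- the decentralized online learning algorithm with deterministic initial values
    (f : Fin N → ℕ → Ω → HK)
    (hf_init : ∀ i, ∃ c : HK, ∀ ω, f i 0 ω = c)
    (hAlg : ∀ i k ω, f i (k + 1) ω = f i k ω
        + (a k * ((⟪f₀, Kx (xi i k ω)⟫ + v i k ω) - ⟪f i k ω, Kx (xi i k ω)⟫)) • Kx (xi i k ω)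
        + b k • ∑ j, A i j • (f j k ω - f i k ω))
    -- positive self-adjoint operators Nⱼ with strictly positive sum
    (Nop : Fin N → HK →L[ℝ] HK)
    (hNop_sa : ∀ j, ∀ g₁ g₂ : HK, ⟪Nop j g₁, g₂⟫ = ⟪g₁, Nop j g₂⟫)
    (hNop_pos : ∀ j, ∀ g : HK, 0 ≤ ⟪Nop j g, g⟫)
    (hNop_strict : ∀ g : HK, g ≠ 0 → 0 < ⟪(∑ j, Nop j) g, g⟫)
    (h : ℕ) (hh : 0 < h)
    (hKK_int : ∀ (j : Fin N) (i : ℕ),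
        Integrable (fun ω => rankOne (Kx (xi j i ω)) (Kx (xi j i ω))) P)
    -- uniform operator-norm excitation bound
    (μ₀ : ℝ) (hμ₀ : 0 < μ₀)
    (τ : ℕ → ℝ) (hτ_nonneg : ∀ k, 0 ≤ τ k) (hτ_sum : Summable τ)
    (hbd : ∀ k : ℕ, ∀ᵐ ω ∂P, ∀ j : Fin N,
        ‖Nop j - ∑ i ∈ Finset.Ico (k * h) ((k + 1) * h),
            (P[fun ω' => rankOne (Kx (xi j i ω')) (Kx (xi j i ω'))
              | rkhsFilt Kx xi v (k * h)]) ω‖ ^ 2 ≤ μ₀ * τ k) :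
    -- mean square, almost sure strong, and pointwise almost sure strong consistency
    (∀ i, Tendsto (fun k => ∫⁻ ω, (‖f i k ω - f₀‖₊ : ℝ≥0∞) ^ 2 ∂P) atTop (nhds 0)) ∧
      (∀ i, ∀ᵐ ω ∂P, Tendsto (fun k => ‖f i k ω - f₀‖) atTop (nhds 0)) ∧
      (∀ x : S, ∀ i, ∀ᵐ ω ∂P,
        Tendsto (fun k => ⟪f i k ω, Kx x⟫) atTop (nhds ⟪f₀, Kx x⟫)) := by
  have hcont : Continuous Kx := continuous_of_continuousOn_kernel hK_cont hKer
  obtain ⟨κ, hκ0, hκ⟩ : ∃ κ : ℝ, 0 ≤ κ ∧ ∀ x, ‖Kx x‖ ≤ κ := by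
    obtain ⟨κ, hκ⟩ := hA5
    refine ⟨√κ, Real.sqrt_nonneg _, fun x => Real.le_sqrt_of_sq_le ?_⟩
    rw [← real_inner_self_eq_norm_sq, hKer]
    exact hκ x
  obtain ⟨C, hC0, hC⟩ := hC3b
  have hNop : ∀ j, (Nop j).IsPositive := fun j =>
    ⟨fun x y => hNop_sa j x y, fun x => by
      rw [ContinuousLinearMap.reApplyInnerSelf_apply]
      exact hNop_pos j x⟩
  let G := inputNoiseFiltration hxi_meas hv_meas
  have hφG : ∀ i s l, StronglyMeasurable[G l] fun ω => Kx (xi i s ω) := fun i s l =>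
    (hcont.stronglyMeasurable.comp_measurable (measurable_inputSigma xi i s)).mono le_sup_left
  have hFG : ∀ k, rkhsFilt Kx xi v k ≤ G k :=
    rkhsFilt_le_sup_noiseHistory Kx xi v fun i s g =>
      (StronglyMeasurable.inner stronglyMeasurable_const
        (hcont.stronglyMeasurable.comp_measurable (measurable_inputSigma xi i s))).measurable
  have hFm : ∀ k, rkhsFilt Kx xi v k ≤ ‹MeasurableSpace Ω› := fun k => (hFG k).trans (G.le k)
  have hφF : ∀ i l, StronglyMeasurable[rkhsFilt Kx xi v (l + 1)] fun ω => Kx (xi i l ω) :=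
    fun i l => stronglyMeasurable_of_measurable_inner
      ((TopologicalSpace.isSeparable_range hcont).mono (Set.range_comp_subset_range _ Kx))
      (measurable_inner_rkhsFilt Kx xi v l.lt_succ_self i)
  have hvF : ∀ i l, StronglyMeasurable[rkhsFilt Kx xi v (l + 1)] (v i l) := fun i l =>
    ((measurable_noiseHistory v l.lt_succ_self i).mono
      (noiseHistory_le_rkhsFilt Kx xi v _) le_rfl).stronglyMeasurable
  have hv2 : ∀ i k, MemLp (v i k) 2 P := fun i k =>
    (memLp_two_iff_integrable_sq (hv_meas i k).aestronglyMeasurable).2 (hA4_int2 i k)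
  have hvG : ∀ k i, P[v i k | G k] =ᵐ[P] 0 := fun k i => by
    have hN : noiseHistory v k ≤ rkhsFilt Kx xi v k := noiseHistory_le_rkhsFilt Kx xi v k
    have h0 : P[v i k | noiseHistory v k] =ᵐ[P] 0 := by
      refine (condExp_condExp_of_le hN (hFm k)).symm.trans ?_
      refine (condExp_congr_ae (hA4_mds i k)).trans ?_
      rw [condExp_zero]
    refine condExp_sup_eq_zero_of_indep ?_ ?_ (noiseHistory_le_iSup v k) hA3 ?_ (hA4_int i k) h0
    · exact iSup₂_le fun i k => (hxi_meas i k).comap_le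
    · refine iSup₂_le fun i k => ?_
      rw [← BorelSpace.measurable_eq (α := ℝ)]
      exact (hv_meas i k).comap_le
    · exact ((measurable_noiseHistory v k.lt_succ_self i).mono
        (noiseHistory_le_iSup v (k + 1)) le_rfl).stronglyMeasurable
  have hYκ : ∀ i l ω, ‖rankOne (Kx (xi i l ω)) (Kx (xi i l ω))‖ ≤ κ ^ 2 := fun i l ω => by
    rw [norm_rankOne_self]
    exact pow_le_pow_left₀ (norm_nonneg _) (hκ _) 2
  let T : ℕ → Ω → (PiLp 2 fun _ : Fin N => HK) →L[ℝ] PiLp 2 fun _ : Fin N => HK :=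
    fun l ω => diagOp fun i => rankOne (Kx (xi i l ω)) (Kx (xi i l ω))
  let R : ℕ → Ω → (PiLp 2 fun _ : Fin N => HK) →L[ℝ] PiLp 2 fun _ : Fin N => HK :=
    fun k ω => diagOp fun i => ∑ l ∈ Finset.range h,
      (P[fun ω' => rankOne (Kx (xi i (k * h + l) ω')) (Kx (xi i (k * h + l) ω'))
        | rkhsFilt Kx xi v (k * h)]) ω
  let e : ℕ → Ω → PiLp 2 fun _ : Fin N => HK := fun l ω => WithLp.toLp 2 fun i => f i l ω - f₀
  let n : ℕ → Ω → PiLp 2 fun _ : Fin N => HK :=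
    fun l ω => WithLp.toLp 2 fun i => v i l ω • Kx (xi i l ω)
  have he0 : ∃ c, e 0 = fun _ => c := by
    choose c hc using hf_init
    exact ⟨WithLp.toLp 2 fun i => c i - f₀, funext fun ω => by simp only [e, hc]⟩
  have hφ2 : ∀ i l, MemLp (fun ω => v i l ω • Kx (xi i l ω)) 2 P := fun i l =>
    (hv2 i l).of_le_mul (c := κ) (((hvF i l).smul (hφF i l)).mono (hFm _)).aestronglyMeasurable
      (ae_of_all _ fun ω => by
        rw [norm_smul, mul_comm]
        exact mul_le_mul_of_nonneg_right (hκ _) (norm_nonneg _))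
  have main := tendsto_zero_of_block_excitation (P := P) (rkhsFilt_mono Kx xi v) (G := G) hFG
    (T := T) (L := networkLaplacian A) (κ := κ ^ 2) (n := n) (e := e) (h := h)
    (Nop := diagOp Nop) (R := R) (r := fun k => √(μ₀ * τ k)) (a := a) (b := b) (C := C)
    (c := N * (κ ^ 2 * β))
    (fun l => stronglyMeasurable_diagOp fun i =>
      continuous_rankOne_self.comp_stronglyMeasurable (hφF i l))
    (fun l => stronglyMeasurable_diagOp fun i =>
      continuous_rankOne_self.comp_stronglyMeasurable (hφG i l l))
    (fun l ω => isPositive_diagOp fun i => isPositive_rankOne_self _)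
    (isPositive_networkLaplacian hA_symm hA_nonneg)
    (fun l ω => norm_diagOp_le (sq_nonneg κ) fun i => hYκ i l ω)
    (fun l => (ha_pos l).le) (fun l => (hb_pos l).le) hC1a hC2a hC2b hC3a hC0.le hC
    (fun l => stronglyMeasurable_toLp fun i => (hvF i l).smul (hφF i l))
    (fun l => memLp_toLp fun i => hφ2 i l)
    (fun l => meanOrthogonal_toLp_smul (G.le l) (hvG l) (fun i => hv2 i l)
      (fun i => hφG i l l) fun i ω => hκ _)
    (fun l => integral_norm_sq_toLp_smul_le (hFm l) (fun i => hA4_int2 i l)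
      (fun i => hA4_bdd i l) fun i ω => hκ _)
    (by obtain ⟨c, hc⟩ := he0; rw [hc]; exact stronglyMeasurable_const)
    (by obtain ⟨c, hc⟩ := he0; rw [hc]; exact memLp_const c)
    (fun l ω => by
      ext i
      simp only [e, n, T, hAlg, PiLp.add_apply, PiLp.sub_apply, PiLp.smul_apply, add_apply,
        smul_apply, diagOp_apply, networkLaplacian_apply]
      have h1 : ∑ j, A i j • (f i l ω - f₀ - (f j l ω - f₀))
          = -∑ j, A i j • (f j l ω - f i l ω) := by
        rw [← Finset.sum_neg_distrib]
        exact Finset.sum_congr rfl fun j _ => by rw [← smul_neg]; congr 1; abel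
      have h2 : rankOne (Kx (xi i l ω)) (Kx (xi i l ω)) (f i l ω - f₀)
          = (⟪f i l ω, Kx (xi i l ω)⟫ - ⟪f₀, Kx (xi i l ω)⟫) • Kx (xi i l ω) := by
        simp [rankOne, inner_sub_right, real_inner_comm, sub_smul]
      rw [h1, h2]
      module)
    hh
    (by
      refine (isPositive_diagOp hNop).add
        ((isPositive_networkLaplacian hA_symm hA_nonneg).smul_of_nonneg (Nat.cast_nonneg h)))
    (fun x hx => inner_diagOp_add_networkLaplacian_pos hA_symm hA_nonneg hconn hNop hNop_strict
      (Nat.cast_pos.2 hh) hx)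
    (fun k => stronglyMeasurable_diagOp fun i => Finset.stronglyMeasurable_fun_sum _ fun l _ =>
      stronglyMeasurable_condExp.mono (hFm _))
    (by
      simp_rw [fun k => Real.sq_sqrt (mul_nonneg hμ₀.le (hτ_nonneg k))]
      exact hτ_sum.mul_left μ₀)
    (fun k => by
      filter_upwards [hbd k] with ω hω
      rw [norm_sub_rev]
      simp only [R, diagOp_sub]
      refine norm_diagOp_le (Real.sqrt_nonneg _) fun i => Real.le_sqrt_of_sq_le ?_
      have := hω i
      rwa [Finset.sum_Ico_eq_sum_range, Nat.succ_mul, Nat.add_sub_cancel_left] at this)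
    (fun k p q hp hq hp2 hq2 => integral_inner_diagOp_sub_condExp (hFm _)
      (fun i l => hKK_int i (k * h + l)) (fun i l ω => hYκ i (k * h + l) ω) _ hp hq hp2 hq2)
  have hle : ∀ i k ω, ‖f i k ω - f₀‖ ≤ ‖e k ω‖ := fun i k ω => PiLp.norm_apply_le (e k ω) i
  have has : ∀ i, ∀ᵐ ω ∂P, Tendsto (fun k => ‖f i k ω - f₀‖) atTop (nhds 0) := fun i => by
    filter_upwards [main.2.2] with ω hω
    exact squeeze_zero (fun k => norm_nonneg _) (fun k => hle i k ω) hω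
  refine ⟨fun i => ?_, has, fun x i => ?_⟩
  · refine tendsto_of_tendsto_of_tendsto_of_le_of_le tendsto_const_nhds
      (by simpa using ENNReal.tendsto_ofReal main.2.1) (fun k => zero_le) fun k => ?_
    rw [ofReal_integral_eq_lintegral_ofReal ((main.1 k).integrable_norm_pow two_ne_zero)
      (ae_of_all _ fun ω => sq_nonneg _)]
    refine lintegral_mono fun ω => ?_
    rw [ENNReal.ofReal_pow (norm_nonneg _), ofReal_norm]
    exact pow_le_pow_left' (enorm_le_iff_norm_le.2 (hle i k ω)) 2
  · filter_upwards [has i] with ω hω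
    exact (tendsto_iff_norm_sub_tendsto_zero.2 hω).inner tendsto_const_nhds
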